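/- arXiv:2306.02062 — 5 statements merged into one kernel-verified Lean document; each statement's English description precedes it below -/
import Mathlib

section
/- Consider the m-th order layered network: for multi-indices (i_1,...,i_m) with 1 ≤ i_k ≤ I_k, the states x_{i_1,...,i_m}(t) ∈ ℝ^n evolve according to d/dt x_{i_1,...,i_m}(t) = f(x_{i_1,...,i_m}(t)) + Σ_{k=1}^m c_k Σ_{j=1}^{I_k} l^{(k)}_{i_k j} x_{i_1,...,i_{k-1},j,i_{k+1},...,i_m}(t) for all t ≥ 0, where f satisfies the QUAD condition with constant α, each coupling strength c_k is nonnegative, and each L^{(k)} = (l^{(k)}_{ij}) is a Laplacian-type coupling matrix with second-eigenvalue bound λ_2^{(k)}. Fix k with 1 ≤ k ≤ m. If c_k λ_2^{(k)} + α < 0, then the network reaches k-th order synchronization: for every multi-index (i_1,...,i_m) and all 1 ≤ p,q ≤ I_k, the norm ‖x_{i_1,...,i_{k-1},p,i_{k+1},...,i_m}(t) − x_{i_1,...,i_{k-1},q,i_{k+1},...,i_m}(t)‖ tends to 0 as t → ∞. -/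
open Filter Topology
open scoped RealInnerProductSpace

lemma aux_scalar (N : ℕ) (A : Matrix (Fin N) (Fin N) ℝ) (hs : A.IsSymm)
    (hr : ∀ i, ∑ j, A i j = 0) (l : ℝ)
    (hl : ∀ v : Fin N → ℝ, (∑ i, v i) = 0 →
      ∑ i, ∑ j, v i * A i j * v j ≤ l * ∑ i, (v i) ^ 2) (u : Fin N → ℝ) :
    ∑ p, ∑ q, (u p - u q) * (∑ j, A p j * u j - ∑ j, A q j * u j)
      ≤ l * ∑ p, ∑ q, (u p - u q) ^ 2 := by
  rcases Nat.eq_zero_or_pos N with h0 | hN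
  · subst h0; simp
  have hN' : (0 : ℝ) < N := by exact_mod_cast hN
  set S := ∑ i, u i with hS
  set w : Fin N → ℝ := fun p => ∑ j, A p j * u j with hw
  have hcol : ∀ j, ∑ i, A i j = 0 := by
    intro j
    rw [← hr j]
    exact Finset.sum_congr rfl fun i _ => hs.apply j i
  have hwsum : ∑ p, w p = 0 := by
    simp only [hw]
    rw [Finset.sum_comm]
    simp [← Finset.sum_mul, hcol]
  set Q := ∑ p, u p * w p with hQ
  set R := ∑ p, u p ^ 2 with hR
  have e1 : ∑ p, ∑ q, (u p - u q) * (w p - w q) = 2 * N * Q := by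
    have : ∀ p, ∑ q, (u p - u q) * (w p - w q) = N * (u p * w p) - w p * S + Q := by
      intro p
      have : ∀ q, (u p - u q) * (w p - w q) = u p * w p - u p * w q - w p * u q + u q * w q := by
        intro q; ring
      simp only [this, Finset.sum_add_distrib, Finset.sum_sub_distrib, ← Finset.mul_sum, hwsum]
      simp [hQ, hS]
      ring
    simp only [this, Finset.sum_add_distrib, Finset.sum_sub_distrib, ← Finset.mul_sum,
      ← Finset.sum_mul, hwsum, ← hQ]
    simp
    ring
  have e2 : ∑ p, ∑ q, (u p - u q) ^ 2 = 2 * N * R - 2 * S ^ 2 := by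
    have : ∀ p, ∑ q, (u p - u q) ^ 2 = N * (u p ^ 2) - 2 * (u p * S) + R := by
      intro p
      have : ∀ q, (u p - u q) ^ 2 = u p ^ 2 - 2 * (u p * u q) + u q ^ 2 := by
        intro q; ring
      simp only [this, Finset.sum_add_distrib, Finset.sum_sub_distrib, ← Finset.mul_sum]
      simp [hR, hS]
    simp only [this, Finset.sum_add_distrib, Finset.sum_sub_distrib, ← Finset.mul_sum,
      ← Finset.sum_mul, ← hR, ← hS]
    simp
    ring
  have hv0 : ∑ i, (N * u i - S) = 0 := by
    simp [Finset.sum_sub_distrib, ← Finset.mul_sum, ← hS]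
  have h := hl (fun i => N * u i - S) hv0
  have e3 : ∑ i, ∑ j, (N * u i - S) * A i j * (N * u j - S) = N ^ 2 * Q := by
    have : ∀ i, ∑ j, (N * u i - S) * A i j * (N * u j - S)
        = N ^ 2 * (u i * w i) - S * N * w i := by
      intro i
      have : ∀ j, (N * u i - S) * A i j * (N * u j - S)
          = (N * u i - S) * N * (A i j * u j) - (N * u i - S) * S * A i j := by
        intro j; ring
      simp only [this, Finset.sum_sub_distrib, ← Finset.mul_sum, hr]
      simp only [hw]
      ring
    simp only [this, Finset.sum_sub_distrib, ← Finset.mul_sum, hwsum, ← hQ]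
    ring
  have e4 : ∑ i, (N * u i - S) ^ 2 = N ^ 2 * R - N * S ^ 2 := by
    have : ∀ i, (N * u i - S) ^ 2 = N ^ 2 * u i ^ 2 - 2 * N * S * u i + S ^ 2 := by
      intro i; ring
    simp only [this, Finset.sum_add_distrib, Finset.sum_sub_distrib, ← Finset.mul_sum, ← hS, ← hR]
    simp
    ring
  rw [e3, e4] at h
  have e1' : ∑ p, ∑ q, (u p - u q) * (∑ j, A p j * u j - ∑ j, A q j * u j) = 2 * N * Q := e1
  rw [e1', e2]
  have h2 : (N : ℝ) * (2 * N * Q) ≤ N * (l * (2 * N * R - 2 * S ^ 2)) := by nlinarith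
  exact le_of_mul_le_mul_left h2 hN'

lemma aux_vector (n N : ℕ) (A : Matrix (Fin N) (Fin N) ℝ) (hs : A.IsSymm)
    (hr : ∀ i, ∑ j, A i j = 0) (l : ℝ)
    (hl : ∀ v : Fin N → ℝ, (∑ i, v i) = 0 →
      ∑ i, ∑ j, v i * A i j * v j ≤ l * ∑ i, (v i) ^ 2)
    (u : Fin N → EuclideanSpace ℝ (Fin n)) :
    ∑ p, ∑ q, ⟪u p - u q, ∑ j, A p j • u j - ∑ j, A q j • u j⟫
      ≤ l * ∑ p, ∑ q, ‖u p - u q‖ ^ 2 := by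
  have h := Finset.sum_le_sum fun (a : Fin n) (_ : a ∈ Finset.univ) =>
    aux_scalar N A hs hr l hl (fun i => u i a)
  have e1 : ∑ p, ∑ q, ⟪u p - u q, ∑ j, A p j • u j - ∑ j, A q j • u j⟫
      = ∑ a, ∑ p, ∑ q, (u p a - u q a) * (∑ j, A p j * u j a - ∑ j, A q j * u j a) := by
    symm
    rw [Finset.sum_comm]
    refine Finset.sum_congr rfl fun p _ => ?_
    rw [Finset.sum_comm]
    refine Finset.sum_congr rfl fun q _ => ?_
    simp [PiLp.inner_apply, mul_comm]
  have e2 : ∑ p, ∑ q, ‖u p - u q‖ ^ 2 = ∑ a, ∑ p, ∑ q, (u p a - u q a) ^ 2 := by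
    symm
    rw [Finset.sum_comm]
    refine Finset.sum_congr rfl fun p _ => ?_
    rw [Finset.sum_comm]
    refine Finset.sum_congr rfl fun q _ => ?_
    simp [EuclideanSpace.norm_sq_eq]
  rw [e1, e2, Finset.mul_sum]
  exact h

lemma aux_fiber {n m : ℕ} {I : Fin m → ℕ} (r : Fin m) (A : Matrix (Fin (I r)) (Fin (I r)) ℝ)
    (hs : A.IsSymm) (hr : ∀ i, ∑ j, A i j = 0) (ho : ∀ i j, i ≠ j → 0 ≤ A i j)
    (E : (∀ k, Fin (I k)) → EuclideanSpace ℝ (Fin n)) :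
    ∑ idx, ⟪E idx, ∑ j, A (idx r) j • E (Function.update idx r j)⟫ ≤ 0 := by
  have hinv : ∀ g : (∀ k, Fin (I k)) × Fin (I r) → ℝ,
      ∑ z, g z = ∑ z : (∀ k, Fin (I k)) × Fin (I r), g (Function.update z.1 r z.2, z.1 r) := by
    intro g
    have hi : Function.Involutive (fun z : (∀ k, Fin (I k)) × Fin (I r) =>
      ((Function.update z.1 r z.2, z.1 r) : (∀ k, Fin (I k)) × Fin (I r))) := by
      rintro ⟨a, b⟩
      simp
    exact (Equiv.sum_comp hi.toPerm g).symm
  have e1 : ∑ idx, ⟪E idx, ∑ j, A (idx r) j • E (Function.update idx r j)⟫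
      = ∑ z : (∀ k, Fin (I k)) × Fin (I r),
        A (z.1 r) z.2 * ⟪E z.1, E (Function.update z.1 r z.2)⟫ := by
    rw [Fintype.sum_prod_type]
    refine Finset.sum_congr rfl fun idx _ => ?_
    simp [inner_sum, inner_smul_right]
  have e2 : ∑ z : (∀ k, Fin (I k)) × Fin (I r), A (z.1 r) z.2 * ‖E z.1‖ ^ 2 = 0 := by
    rw [Fintype.sum_prod_type]
    simp [← Finset.sum_mul, hr]
  have e3 : ∑ z : (∀ k, Fin (I k)) × Fin (I r),
      A (z.1 r) z.2 * ‖E (Function.update z.1 r z.2)‖ ^ 2 = 0 := by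
    rw [← e2, hinv (fun z => A (z.1 r) z.2 * ‖E z.1‖ ^ 2)]
    refine Finset.sum_congr rfl fun z _ => ?_
    simp [hs.apply (z.1 r) z.2]
  have e4 : 0 ≤ ∑ z : (∀ k, Fin (I k)) × Fin (I r),
      A (z.1 r) z.2 * ‖E z.1 - E (Function.update z.1 r z.2)‖ ^ 2 := by
    refine Finset.sum_nonneg fun z _ => ?_
    by_cases h : z.1 r = z.2
    · rw [← h]; simp
    · exact mul_nonneg (ho _ _ h) (by positivity)
  have e5 : ∀ z : (∀ k, Fin (I k)) × Fin (I r),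
      A (z.1 r) z.2 * ‖E z.1 - E (Function.update z.1 r z.2)‖ ^ 2
      = A (z.1 r) z.2 * ‖E z.1‖ ^ 2 - 2 * (A (z.1 r) z.2 * ⟪E z.1, E (Function.update z.1 r z.2)⟫)
        + A (z.1 r) z.2 * ‖E (Function.update z.1 r z.2)‖ ^ 2 := by
    intro z
    rw [norm_sub_sq_real]; ring
  simp only [e5, Finset.sum_add_distrib, Finset.sum_sub_distrib, ← Finset.mul_sum, e2, e3] at e4
  rw [e1]
  linarith

lemma aux_decay (V V' : ℝ → ℝ) (b : ℝ) (hb : b < 0) (hV0 : ∀ t, 0 ≤ V t)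
    (hd : ∀ t, 0 ≤ t → HasDerivAt V (V' t) t) (hle : ∀ t, 0 ≤ t → V' t ≤ b * V t) :
    Tendsto V atTop (𝓝 0) := by
  have hW : ∀ t, 0 ≤ t → HasDerivAt (fun t => V t * Real.exp (-b * t))
      (V' t * Real.exp (-b * t) + V t * (Real.exp (-b * t) * (-b))) t := by
    intro t ht
    have h1 : HasDerivAt (fun t : ℝ => -b * t) (-b) t := by
      simpa using (hasDerivAt_id t).const_mul (-b)
    exact (hd t ht).mul h1.exp
  have hanti : AntitoneOn (fun t => V t * Real.exp (-b * t)) (Set.Ici 0) := by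
    apply antitoneOn_of_deriv_nonpos (convex_Ici 0)
    · exact fun t ht => (hW t ht).continuousAt.continuousWithinAt
    · intro t ht
      rw [interior_Ici] at ht
      exact (hW t (le_of_lt ht)).differentiableAt.differentiableWithinAt
    · intro t ht
      rw [interior_Ici] at ht
      rw [(hW t (le_of_lt ht)).deriv]
      have := hle t (le_of_lt ht)
      have h2 := Real.exp_pos (-b * t)
      nlinarith
  have hbound : ∀ t, 0 ≤ t → V t ≤ V 0 * Real.exp (b * t) := by
    intro t ht
    have h := hanti (Set.mem_Ici.2 le_rfl) (Set.mem_Ici.2 ht) ht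
    simp only [mul_zero, Real.exp_zero, mul_one] at h
    have h3 : Real.exp (-b * t) * Real.exp (b * t) = 1 := by
      rw [← Real.exp_add]; simp
    calc V t = V t * Real.exp (-b * t) * Real.exp (b * t) := by rw [mul_assoc, h3, mul_one]
      _ ≤ _ := mul_le_mul_of_nonneg_right h (Real.exp_pos _).le
  have hlim : Tendsto (fun t => V 0 * Real.exp (b * t)) atTop (𝓝 0) := by
    have : Tendsto (fun t : ℝ => b * t) atTop atBot :=
      tendsto_id.const_mul_atTop_of_neg hb
    simpa using (Real.tendsto_exp_atBot.comp this).const_mul (V 0)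
  refine squeeze_zero' (Eventually.of_forall hV0) ?_ hlim
  filter_upwards [eventually_ge_atTop 0] with t ht using hbound t ht

/-- k-th order synchronization of the m-th order layered network
under the condition `c k * λ₂ k + α < 0`. -/
theorem kth_order_synchronization
    (n m : ℕ) (I : Fin m → ℕ)
    (f : EuclideanSpace ℝ (Fin n) → EuclideanSpace ℝ (Fin n))
    (hf : Continuous f) (α : ℝ)
    (hquad : ∀ x y : EuclideanSpace ℝ (Fin n), ⟪x - y, f x - f y⟫ ≤ α * ‖x - y‖ ^ 2)
    (c : Fin m → ℝ) (hc : ∀ k, 0 ≤ c k)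
    (L : ∀ k, Matrix (Fin (I k)) (Fin (I k)) ℝ)
    (hLsym : ∀ k, (L k).IsSymm)
    (hLrow : ∀ k i, ∑ j, L k i j = 0)
    (hLoff : ∀ k, ∀ i j, i ≠ j → 0 ≤ L k i j)
    (lam : Fin m → ℝ)
    (hlam : ∀ k, ∀ v : Fin (I k) → ℝ, (∑ i, v i) = 0 →
      ∑ i, ∑ j, v i * L k i j * v j ≤ lam k * ∑ i, (v i) ^ 2)
    (x : (∀ k, Fin (I k)) → ℝ → EuclideanSpace ℝ (Fin n))
    (hode : ∀ idx, ∀ t : ℝ, 0 ≤ t → HasDerivAt (x idx)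
      (f (x idx t) + ∑ k, c k • ∑ j, L k (idx k) j • x (Function.update idx k j) t) t)
    (k : Fin m) (hsync : c k * lam k + α < 0) :
    ∀ idx : ∀ k, Fin (I k), ∀ p q : Fin (I k),
      Tendsto (fun t : ℝ =>
          ‖x (Function.update idx k p) t - x (Function.update idx k q) t‖)
        atTop (𝓝 0) := by
  classical
  -- pointwise energy estimate
  have key : ∀ y : (∀ k, Fin (I k)) → EuclideanSpace ℝ (Fin n),
      ∑ idx : ∀ k, Fin (I k), ∑ p : Fin (I k), ∑ q : Fin (I k),
        2 * ⟪y (Function.update idx k p) - y (Function.update idx k q),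
          (f (y (Function.update idx k p)) + ∑ r, c r • ∑ j, L r (Function.update idx k p r) j •
            y (Function.update (Function.update idx k p) r j)) -
          (f (y (Function.update idx k q)) + ∑ r, c r • ∑ j, L r (Function.update idx k q r) j •
            y (Function.update (Function.update idx k q) r j))⟫
      ≤ (2 * (c k * lam k + α)) * ∑ idx : ∀ k, Fin (I k), ∑ p : Fin (I k), ∑ q : Fin (I k),
        ‖y (Function.update idx k p) - y (Function.update idx k q)‖ ^ 2 := by
    intro y
    set W := ∑ idx : ∀ k, Fin (I k), ∑ p : Fin (I k), ∑ q : Fin (I k),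
        ‖y (Function.update idx k p) - y (Function.update idx k q)‖ ^ 2 with hW
    let G : Fin m → (∀ k, Fin (I k)) → EuclideanSpace ℝ (Fin n) := fun r idx =>
      ∑ j, L r (idx r) j • y (Function.update idx r j)
    let T : Fin m → ℝ := fun r => ∑ idx : ∀ k, Fin (I k), ∑ p : Fin (I k), ∑ q : Fin (I k),
      ⟪y (Function.update idx k p) - y (Function.update idx k q),
        G r (Function.update idx k p) - G r (Function.update idx k q)⟫
    have hTk : T k ≤ lam k * W := by
      rw [hW, Finset.mul_sum]
      refine Finset.sum_le_sum fun idx _ => ?_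
      have := aux_vector n (I k) (L k) (hLsym k) (hLrow k) (lam k) (hlam k)
        (fun p => y (Function.update idx k p))
      simpa [G] using this
    have hTr : ∀ r, r ≠ k → T r ≤ 0 := by
      intro r hrk
      have e : T r = ∑ p : Fin (I k), ∑ q : Fin (I k), ∑ idx : ∀ k, Fin (I k),
          ⟪y (Function.update idx k p) - y (Function.update idx k q),
            ∑ j, L r (idx r) j • (y (Function.update (Function.update idx r j) k p) -
              y (Function.update (Function.update idx r j) k q))⟫ := by
        simp only [T]
        rw [Finset.sum_comm]
        refine Finset.sum_congr rfl fun p _ => ?_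
        rw [Finset.sum_comm]
        refine Finset.sum_congr rfl fun q _ => ?_
        refine Finset.sum_congr rfl fun idx _ => ?_
        congr 1
        simp only [G, smul_sub, Finset.sum_sub_distrib, Function.update_of_ne hrk]
        congr 1 <;> refine Finset.sum_congr rfl fun j _ => ?_
        · rw [Function.update_comm hrk]
        · rw [Function.update_comm hrk]
      rw [e]
      refine Finset.sum_nonpos fun p _ => Finset.sum_nonpos fun q _ => ?_
      exact aux_fiber r (L r) (hLsym r) (hLrow r) (hLoff r)
        (fun idx => y (Function.update idx k p) - y (Function.update idx k q))
    have hsum : ∑ r, c r * T r ≤ c k * lam k * W := by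
      calc ∑ r, c r * T r ≤ ∑ r, if r = k then c k * lam k * W else 0 := by
            refine Finset.sum_le_sum fun r _ => ?_
            split_ifs with h
            · subst h
              rw [mul_assoc]
              exact mul_le_mul_of_nonneg_left hTk (hc r)
            · exact mul_nonpos_of_nonneg_of_nonpos (hc r) (hTr r h)
        _ = _ := by simp
    have hF : ∑ idx : ∀ k, Fin (I k), ∑ p : Fin (I k), ∑ q : Fin (I k),
        ⟪y (Function.update idx k p) - y (Function.update idx k q),
          f (y (Function.update idx k p)) - f (y (Function.update idx k q))⟫ ≤ α * W := by
      rw [hW]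
      simp only [Finset.mul_sum]
      exact Finset.sum_le_sum fun idx _ => Finset.sum_le_sum fun p _ =>
        Finset.sum_le_sum fun q _ => hquad _ _
    have hexp : ∀ (idx : ∀ k, Fin (I k)) (p q : Fin (I k)),
        ⟪y (Function.update idx k p) - y (Function.update idx k q),
          (f (y (Function.update idx k p)) + ∑ r, c r • G r (Function.update idx k p)) -
          (f (y (Function.update idx k q)) + ∑ r, c r • G r (Function.update idx k q))⟫
        = ⟪y (Function.update idx k p) - y (Function.update idx k q),
          f (y (Function.update idx k p)) - f (y (Function.update idx k q))⟫
        + ∑ r, c r * ⟪y (Function.update idx k p) - y (Function.update idx k q),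
            G r (Function.update idx k p) - G r (Function.update idx k q)⟫ := by
      intro idx p q
      rw [add_sub_add_comm, inner_add_right, ← Finset.sum_sub_distrib, inner_sum]
      simp only [← smul_sub, inner_smul_right]
    have hcomm : ∑ r, c r * T r = ∑ idx : ∀ k, Fin (I k), ∑ p : Fin (I k), ∑ q : Fin (I k),
        ∑ r, c r * ⟪y (Function.update idx k p) - y (Function.update idx k q),
            G r (Function.update idx k p) - G r (Function.update idx k q)⟫ := by
      simp only [T, Finset.mul_sum]
      rw [Finset.sum_comm]
      refine Finset.sum_congr rfl fun idx _ => ?_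
      rw [Finset.sum_comm]
      refine Finset.sum_congr rfl fun p _ => ?_
      rw [Finset.sum_comm]
    change ∑ idx : ∀ k, Fin (I k), ∑ p : Fin (I k), ∑ q : Fin (I k),
        2 * ⟪y (Function.update idx k p) - y (Function.update idx k q),
          (f (y (Function.update idx k p)) + ∑ r, c r • G r (Function.update idx k p)) -
          (f (y (Function.update idx k q)) + ∑ r, c r • G r (Function.update idx k q))⟫ ≤ _
    simp only [hexp, ← Finset.mul_sum]
    simp only [Finset.sum_add_distrib]
    rw [← hcomm]
    nlinarith
  intro idx p q
  have hlim := aux_decay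
    (fun t => ∑ idx : ∀ k, Fin (I k), ∑ p : Fin (I k), ∑ q : Fin (I k),
        ‖x (Function.update idx k p) t - x (Function.update idx k q) t‖ ^ 2) _
    (2 * (c k * lam k + α)) (by linarith) (fun t => by positivity)
    (fun t ht => HasDerivAt.fun_sum fun idx _ => HasDerivAt.fun_sum fun p _ =>
      HasDerivAt.fun_sum fun q _ =>
        ((hode (Function.update idx k p) t ht).sub (hode (Function.update idx k q) t ht)).norm_sq)
    (fun t _ => key (fun idx => x idx t))
  have hsq : Tendsto (fun t : ℝ =>
      ‖x (Function.update idx k p) t - x (Function.update idx k q) t‖ ^ 2) atTop (𝓝 0) := by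
    refine squeeze_zero (fun t => by positivity) (fun t => ?_) hlim
    refine le_trans ?_ (Finset.single_le_sum (f := fun idx : ∀ k, Fin (I k) =>
      ∑ p : Fin (I k), ∑ q : Fin (I k),
        ‖x (Function.update idx k p) t - x (Function.update idx k q) t‖ ^ 2)
      (fun _ _ => by positivity) (Finset.mem_univ idx))
    refine le_trans ?_ (Finset.single_le_sum (f := fun p : Fin (I k) => ∑ q : Fin (I k),
        ‖x (Function.update idx k p) t - x (Function.update idx k q) t‖ ^ 2)
      (fun _ _ => by positivity) (Finset.mem_univ p))
    exact Finset.single_le_sum (f := fun q : Fin (I k) =>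
        ‖x (Function.update idx k p) t - x (Function.update idx k q) t‖ ^ 2)
      (fun _ _ => by positivity) (Finset.mem_univ q)
  have := hsq.sqrt
  simpa using this
end

section
/- Consider the m-th order layered network: for multi-indices (i_1,...,i_m) with 1 ≤ i_k ≤ I_k, the states x_{i_1,...,i_m}(t) ∈ ℝ^n evolve according to d/dt x_{i_1,...,i_m}(t) = f(x_{i_1,...,i_m}(t)) + Σ_{k=1}^m c_k Σ_{j=1}^{I_k} l^{(k)}_{i_k j} x_{i_1,...,i_{k-1},j,i_{k+1},...,i_m}(t) for all t ≥ 0, where f satisfies the QUAD condition with constant α, each coupling strength c_k is nonnegative, and each L^{(k)} = (l^{(k)}_{ij}) is a Laplacian-type coupling matrix with second-eigenvalue bound λ_2^{(k)}. If max_{k=1,...,m}(c_k λ_2^{(k)} + α) < 0, then the network realizes complete synchronization: for all multi-indices (i_1,...,i_m) and (j_1,...,j_m), the norm ‖x_{i_1,...,i_m}(t) − x_{j_1,...,j_m}(t)‖ tends to 0 as t → ∞. -/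
open Filter Topology
open scoped RealInnerProductSpace

section helpers

variable {ι : Type} [Fintype ι] [DecidableEq ι] {J : ι → Type} [∀ k, Fintype (J k)]

/-- Summing over lines in direction `k` counts every index `card (J k)` times. -/
lemma sum_line (k : ι) (F : (∀ k, J k) → ℝ) :
    ∑ idx, ∑ j, F (Function.update idx k j) = (Fintype.card (J k) : ℝ) * ∑ idx, F idx := by
  have h : ∑ p : (∀ k, J k) × J k, F (Function.update p.1 k p.2)
      = ∑ p : (∀ k, J k) × J k, F p.1 := by
    refine Finset.sum_bij' (fun p _ => (Function.update p.1 k p.2, p.1 k))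
      (fun p _ => (Function.update p.1 k p.2, p.1 k)) ?_ ?_ ?_ ?_ ?_ <;> simp
  rw [Fintype.sum_prod_type, Fintype.sum_prod_type] at h
  rw [h]
  simp [Finset.mul_sum]

/-- Line averaging in direction `k`. -/
noncomputable def avg (k : ι) (u : (∀ k, J k) → ℝ) (idx : ∀ k, J k) : ℝ :=
  (∑ j, u (Function.update idx k j)) / (Fintype.card (J k) : ℝ)

lemma avg_update (k : ι) (u : (∀ k, J k) → ℝ) (idx : ∀ k, J k) (j : J k) :
    avg k u (Function.update idx k j) = avg k u idx := by
  simp [avg]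

lemma avg_sub (k : ι) (u v : (∀ k, J k) → ℝ) : avg k (u - v) = avg k u - avg k v := by
  funext idx
  simp [avg, sub_div]

variable [∀ k, Nonempty (J k)]

lemma card_pos' (k : ι) : (0 : ℝ) < (Fintype.card (J k) : ℝ) := by
  exact_mod_cast Fintype.card_pos

lemma avg_fixed (k : ι) (u : (∀ k, J k) → ℝ)
    (h : ∀ idx j, u (Function.update idx k j) = u idx) : avg k u = u := by
  funext idx
  have := (card_pos' (J := J) k).ne'
  simp only [avg, h]
  simp

lemma avg_avg (k : ι) (u : (∀ k, J k) → ℝ) : avg k (avg k u) = avg k u :=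
  avg_fixed k _ (avg_update k u)

lemma avg_comm (k l : ι) (u : (∀ k, J k) → ℝ) : avg k (avg l u) = avg l (avg k u) := by
  by_cases h : k = l
  · subst h; rfl
  funext idx
  simp only [avg, ← Finset.sum_div]
  rw [Finset.sum_comm, div_right_comm]
  congr 2
  refine Finset.sum_congr rfl fun i _ => Finset.sum_congr rfl fun j _ => ?_
  rw [Function.update_comm h]

lemma sum_avg (k : ι) (u : (∀ k, J k) → ℝ) : ∑ idx, avg k u idx = ∑ idx, u idx := by
  have := (card_pos' (J := J) k).ne'
  simp only [avg, ← Finset.sum_div]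
  rw [sum_line]
  field_simp

lemma avg_pyth (k : ι) (u : (∀ k, J k) → ℝ) :
    ∑ idx, u idx ^ 2 = ∑ idx, avg k u idx ^ 2 + ∑ idx, (u - avg k u) idx ^ 2 := by
  have hc := card_pos' (J := J) k
  rw [← Finset.sum_add_distrib]
  apply mul_left_cancel₀ hc.ne'
  rw [← sum_line k (fun idx => u idx ^ 2), ← sum_line k]
  refine Finset.sum_congr rfl fun idx _ => ?_
  simp only [Pi.sub_apply, avg_update]
  have h1 : ∑ j, u (Function.update idx k j) = avg k u idx * (Fintype.card (J k) : ℝ) := by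
    simp only [avg]; field_simp
  have h2 : ∀ j, avg k u idx ^ 2 + (u (Function.update idx k j) - avg k u idx) ^ 2
      = u (Function.update idx k j) ^ 2 - 2 * avg k u idx * u (Function.update idx k j)
        + 2 * avg k u idx ^ 2 := fun j => by ring
  simp only [h2, Finset.sum_add_distrib, Finset.sum_sub_distrib, ← Finset.mul_sum, h1]
  simp
  ring

lemma avg_contr (k : ι) (u : (∀ k, J k) → ℝ) :
    ∑ idx, avg k u idx ^ 2 ≤ ∑ idx, u idx ^ 2 := by
  rw [avg_pyth k u]
  have : 0 ≤ ∑ idx, (u - avg k u) idx ^ 2 := Finset.sum_nonneg fun _ _ => sq_nonneg _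
  linarith

/-- Iterated averaging. -/
noncomputable def avgL (l : List ι) (u : (∀ k, J k) → ℝ) : (∀ k, J k) → ℝ :=
  l.foldr (fun k w => avg k w) u

lemma avgL_comm (k : ι) (l : List ι) (u : (∀ k, J k) → ℝ) :
    avgL l (avg k u) = avg k (avgL l u) := by
  induction l with
  | nil => rfl
  | cons h l ih =>
    change avg h (avgL l (avg k u)) = avg k (avg h (avgL l u))
    rw [ih, avg_comm]

lemma avgL_sub (l : List ι) (u v : (∀ k, J k) → ℝ) : avgL l (u - v) = avgL l u - avgL l v := by
  induction l with
  | nil => rfl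
  | cons h l ih =>
    change avg h (avgL l (u - v)) = avg h (avgL l u) - avg h (avgL l v)
    rw [ih, avg_sub]

lemma avgL_contr (l : List ι) (u : (∀ k, J k) → ℝ) :
    ∑ idx, avgL l u idx ^ 2 ≤ ∑ idx, u idx ^ 2 := by
  induction l with
  | nil => exact le_rfl
  | cons h l ih => exact (avg_contr h (avgL l u)).trans ih

lemma sum_avgL (l : List ι) (u : (∀ k, J k) → ℝ) :
    ∑ idx, avgL l u idx = ∑ idx, u idx := by
  induction l with
  | nil => rfl
  | cons h l ih => exact (sum_avg h (avgL l u)).trans ih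

lemma avgL_fixed (l : List ι) (u : (∀ k, J k) → ℝ) (k : ι) (hk : k ∈ l) :
    avg k (avgL l u) = avgL l u := by
  induction l with
  | nil => simp at hk
  | cons h l ih =>
    change avg k (avg h (avgL l u)) = avg h (avgL l u)
    rcases List.mem_cons.1 hk with rfl | hk
    · exact avg_avg _ _
    · rw [avg_comm, ih hk]

lemma efron_list (l : List ι) (u : (∀ k, J k) → ℝ) :
    ∑ idx, u idx ^ 2 ≤ (l.map fun k => ∑ idx, (u - avg k u) idx ^ 2).sum
      + ∑ idx, avgL l u idx ^ 2 := by
  induction l with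
  | nil => simp [avgL]
  | cons h l ih =>
    have h1 := avg_pyth h (avgL l u)
    rw [← avgL_comm, ← avgL_sub] at h1
    have h2 := avgL_contr l (u - avg h u)
    have h3 : avgL (h :: l) u = avgL l (avg h u) := (avgL_comm h l u).symm
    rw [h3, List.map_cons, List.sum_cons]
    linarith

/-- Efron–Stein type inequality. -/
lemma efron (u : (∀ k, J k) → ℝ) (hu : ∑ idx, u idx = 0) :
    ∑ idx, u idx ^ 2 ≤ ∑ k, ∑ idx, (u - avg k u) idx ^ 2 := by
  have h := efron_list (Finset.univ : Finset ι).toList u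
  rw [Finset.sum_map_toList] at h
  set w := avgL (Finset.univ : Finset ι).toList u with hw
  have hfix : ∀ k, avg k w = w := fun k => avgL_fixed _ _ k (by simp)
  have hinv : ∀ k idx j, w (Function.update idx k j) = w idx := fun k idx j => by
    rw [← hfix k, avg_update]
  have hconst : ∀ idx jdx, w jdx = w idx := by
    intro idx jdx
    have : ∀ s : Finset ι, w (s.piecewise jdx idx) = w idx := by
      intro s
      induction s using Finset.induction_on with
      | empty => simp
      | insert a s _ ih => rw [Finset.piecewise_insert, hinv, ih]
    simpa using this Finset.univ
  have hsum : ∑ idx, w idx = 0 := (sum_avgL _ u).trans hu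
  have hz : ∀ idx, w idx = 0 := by
    intro idx
    rw [Finset.sum_congr rfl fun jdx _ => hconst idx jdx] at hsum
    have hne : ∏ i, (Fintype.card (J i) : ℝ) ≠ 0 :=
      Finset.prod_ne_zero_iff.2 fun i _ => (card_pos' (J := J) i).ne'
    simpa [hne] using hsum
  simpa [hz] using h

lemma quad_shift {K : Type} [Fintype K] (L : Matrix K K ℝ) (hs : L.IsSymm)
    (hr : ∀ i, ∑ j, L i j = 0) (v : K → ℝ) (a : ℝ) :
    ∑ i, ∑ j, (v i - a) * L i j * (v j - a) = ∑ i, ∑ j, v i * L i j * v j := by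
  have hcol : ∀ j, ∑ i, L i j = 0 := fun j => by
    rw [← hr j]; exact Finset.sum_congr rfl fun i _ => hs.apply j i
  have e : ∀ i j, (v i - a) * L i j * (v j - a)
      = v i * L i j * v j - a * (v i * L i j) - a * (L i j * v j) + a * a * L i j :=
    fun i j => by ring
  have z1 : ∑ i, ∑ j, L i j * v j = 0 := by
    rw [Finset.sum_comm]; simp [← Finset.sum_mul, hcol]
  simp only [e, Finset.sum_add_distrib, Finset.sum_sub_distrib, ← Finset.mul_sum, hr, z1]
  simp

lemma quad_nonpos {K : Type} [Fintype K] (L : Matrix K K ℝ) (hs : L.IsSymm)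
    (hr : ∀ i, ∑ j, L i j = 0) (ho : ∀ i j, i ≠ j → 0 ≤ L i j) (v : K → ℝ) :
    ∑ i, ∑ j, v i * L i j * v j ≤ 0 := by
  have hcol : ∀ j, ∑ i, L i j = 0 := fun j => by
    rw [← hr j]; exact Finset.sum_congr rfl fun i _ => hs.apply j i
  have e : ∀ i j, L i j * (v i - v j) ^ 2
      = v i ^ 2 * L i j + L i j * v j ^ 2 - 2 * (v i * L i j * v j) :=
    fun i j => by ring
  have h0 : 0 ≤ ∑ i, ∑ j, L i j * (v i - v j) ^ 2 := by
    refine Finset.sum_nonneg fun i _ => Finset.sum_nonneg fun j _ => ?_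
    by_cases h : i = j
    · simp [h]
    · exact mul_nonneg (ho i j h) (sq_nonneg _)
  have z1 : ∑ i, ∑ j, L i j * v j ^ 2 = 0 := by
    rw [Finset.sum_comm]; simp [← Finset.sum_mul, hcol]
  simp only [e, Finset.sum_add_distrib, Finset.sum_sub_distrib, z1, ← Finset.mul_sum, hr] at h0
  simp only [mul_zero, Finset.sum_const_zero] at h0
  linarith

/-- Coercivity of the total coupling on functions of zero sum. -/
lemma coupling_bound (L : ∀ k, Matrix (J k) (J k) ℝ) (hs : ∀ k, (L k).IsSymm)
    (hr : ∀ k i, ∑ j, L k i j = 0) (c : ι → ℝ) (g : ℝ) (hg : 0 ≤ g)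
    (hL : ∀ k, ∀ v : J k → ℝ, (∑ i, v i) = 0 →
      c k * ∑ i, ∑ j, v i * L k i j * v j ≤ - g * ∑ i, v i ^ 2)
    (u : (∀ k, J k) → ℝ) (hu : ∑ idx, u idx = 0) :
    ∑ k, c k * ∑ idx, ∑ j, u idx * L k (idx k) j * u (Function.update idx k j)
      ≤ - g * ∑ idx, u idx ^ 2 := by
  have key : ∀ k, c k * ∑ idx, ∑ j, u idx * L k (idx k) j * u (Function.update idx k j)
      ≤ - g * ∑ idx, (u - avg k u) idx ^ 2 := by
    intro k
    have hc := card_pos' (J := J) k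
    refine le_of_mul_le_mul_left ?_ hc
    rw [mul_left_comm, mul_left_comm _ (-g), ← sum_line k, ← sum_line k, Finset.mul_sum,
      Finset.mul_sum]
    refine Finset.sum_le_sum fun idx _ => ?_
    have h := hL k (fun j => u (Function.update idx k j) - avg k u idx) (by
      simp only [Finset.sum_sub_distrib, avg]
      simp
      field_simp
      simp)
    rw [quad_shift (L k) (hs k) (hr k) (fun j => u (Function.update idx k j))] at h
    simpa [avg_update] using h
  calc _ ≤ ∑ k, - g * ∑ idx, (u - avg k u) idx ^ 2 := Finset.sum_le_sum fun k _ => key k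
    _ = - g * ∑ k, ∑ idx, (u - avg k u) idx ^ 2 := by rw [Finset.mul_sum]
    _ ≤ _ := by
      have := mul_le_mul_of_nonneg_left (efron u hu) hg
      linarith

end helpers

lemma decay (V V' : ℝ → ℝ) (d : ℝ) (hd : 0 < d)
    (hV : ∀ t, 0 ≤ t → HasDerivAt V (V' t) t) (hle : ∀ t, 0 ≤ t → V' t ≤ - d * V t)
    (h0 : ∀ t, 0 ≤ V t) : Tendsto V atTop (𝓝 0) := by
  have hW : ∀ t, 0 ≤ t → HasDerivAt (fun t => V t * Real.exp (d * t))
      (V' t * Real.exp (d * t) + V t * (Real.exp (d * t) * (d * 1))) t := fun t ht =>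
    (hV t ht).mul (((hasDerivAt_id t).const_mul d).exp)
  have hanti : AntitoneOn (fun t => V t * Real.exp (d * t)) (Set.Ici 0) := by
    refine antitoneOn_of_deriv_nonpos (convex_Ici 0)
      (fun t ht => (hW t ht).continuousAt.continuousWithinAt)
      (fun t ht => ?_) (fun t ht => ?_)
    · rw [interior_Ici] at ht
      exact (hW t (le_of_lt ht)).differentiableAt.differentiableWithinAt
    · rw [interior_Ici] at ht
      rw [(hW t (le_of_lt ht)).deriv]
      have := mul_le_mul_of_nonneg_right (hle t (le_of_lt ht)) (Real.exp_pos (d * t)).le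
      linarith
  have hb : ∀ t, 0 ≤ t → V t ≤ V 0 * Real.exp (-(d * t)) := by
    intro t ht
    have h : V t * Real.exp (d * t) ≤ V 0 * Real.exp (d * 0) :=
      hanti (Set.mem_Ici.2 le_rfl) (Set.mem_Ici.2 ht) ht
    rw [mul_zero, Real.exp_zero, mul_one] at h
    rw [Real.exp_neg, ← div_eq_mul_inv, le_div_iff₀ (Real.exp_pos _)]
    exact h
  have hlim : Tendsto (fun t => V 0 * Real.exp (-(d * t))) atTop (𝓝 0) := by
    have := (Real.tendsto_exp_neg_atTop_nhds_zero.comp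
      (tendsto_id.const_mul_atTop hd)).const_mul (V 0)
    simpa using this
  refine tendsto_of_tendsto_of_tendsto_of_le_of_le' tendsto_const_nhds hlim
    (Eventually.of_forall h0) ?_
  filter_upwards [eventually_ge_atTop 0] with t ht using hb t ht

/-- complete synchronization of the m-th order layered network
when `c k * λ₂ k + α < 0` for every `k` (i.e. the maximum over `k` is negative). -/
theorem complete_synchronization
    (n m : ℕ) (I : Fin m → ℕ)
    (f : EuclideanSpace ℝ (Fin n) → EuclideanSpace ℝ (Fin n))
    (hf : Continuous f) (α : ℝ)
    (hquad : ∀ x y : EuclideanSpace ℝ (Fin n), ⟪x - y, f x - f y⟫ ≤ α * ‖x - y‖ ^ 2)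
    (c : Fin m → ℝ) (hc : ∀ k, 0 ≤ c k)
    (L : ∀ k, Matrix (Fin (I k)) (Fin (I k)) ℝ)
    (hLsym : ∀ k, (L k).IsSymm)
    (hLrow : ∀ k i, ∑ j, L k i j = 0)
    (hLoff : ∀ k, ∀ i j, i ≠ j → 0 ≤ L k i j)
    (lam : Fin m → ℝ)
    (hlam : ∀ k, ∀ v : Fin (I k) → ℝ, (∑ i, v i) = 0 →
      ∑ i, ∑ j, v i * L k i j * v j ≤ lam k * ∑ i, (v i) ^ 2)
    (x : (∀ k, Fin (I k)) → ℝ → EuclideanSpace ℝ (Fin n))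
    (hode : ∀ idx, ∀ t : ℝ, 0 ≤ t → HasDerivAt (x idx)
      (f (x idx t) + ∑ k, c k • ∑ j, L k (idx k) j • x (Function.update idx k j) t) t)
    (hsync : ∀ k, c k * lam k + α < 0) :
    ∀ idx jdx : ∀ k, Fin (I k),
      Tendsto (fun t : ℝ => ‖x idx t - x jdx t‖) atTop (𝓝 0) := by
  intro idx₀ jdx₀
  haveI : ∀ k, Nonempty (Fin (I k)) := fun k => ⟨idx₀ k⟩
  -- the constant
  obtain ⟨g, hg0, hgα, hgk⟩ : ∃ g : ℝ, 0 ≤ g ∧ α < g ∧ ∀ k, ∀ v : Fin (I k) → ℝ,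
      (∑ i, v i) = 0 → c k * ∑ i, ∑ j, v i * L k i j * v j ≤ - g * ∑ i, v i ^ 2 := by
    have h1 : ∀ᶠ b in 𝓝[>] α, ∀ k, b < -(c k * lam k) := by
      rw [eventually_all]
      intro k
      exact nhdsWithin_le_nhds (eventually_lt_nhds (by linarith [hsync k]))
    obtain ⟨b, hb, hbα⟩ := (h1.and self_mem_nhdsWithin).exists
    refine ⟨max b 0, le_max_right _ _, lt_max_of_lt_left hbα, fun k v hv => ?_⟩
    rcases le_total b 0 with hb0 | hb0
    · rw [max_eq_right hb0]
      have := mul_le_mul_of_nonneg_left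
        (quad_nonpos (L k) (hLsym k) (hLrow k) (hLoff k) v) (hc k)
      simpa using this
    · rw [max_eq_left hb0]
      have h2 := mul_le_mul_of_nonneg_left (hlam k v hv) (hc k)
      have h3 : 0 ≤ ∑ i, v i ^ 2 := Finset.sum_nonneg fun _ _ => sq_nonneg _
      have h4 := mul_le_mul_of_nonneg_right (hb k).le h3
      linarith
  -- the mean and deviations
  set N : ℝ := (Fintype.card (∀ k, Fin (I k)) : ℝ) with hN
  haveI : Nonempty (∀ k, Fin (I k)) := ⟨idx₀⟩
  have hNpos : 0 < N := by rw [hN]; exact_mod_cast Fintype.card_pos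
  let D : (∀ k, Fin (I k)) → ℝ → EuclideanSpace ℝ (Fin n) := fun idx t =>
    f (x idx t) + ∑ k, c k • ∑ j, L k (idx k) j • x (Function.update idx k j) t
  let xb : ℝ → EuclideanSpace ℝ (Fin n) := fun t => N⁻¹ • ∑ idx, x idx t
  let u : (∀ k, Fin (I k)) → ℝ → EuclideanSpace ℝ (Fin n) := fun idx t => x idx t - xb t
  have hu0 : ∀ t, ∑ idx, u idx t = 0 := by
    intro t
    simp only [u, xb, Finset.sum_sub_distrib, Finset.sum_const, Finset.card_univ]
    rw [← Nat.cast_smul_eq_nsmul ℝ, ← hN, smul_smul, mul_inv_cancel₀ hNpos.ne', one_smul, sub_self]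
  have hxb : ∀ t, 0 ≤ t → HasDerivAt xb (N⁻¹ • ∑ idx, D idx t) t := fun t ht =>
    (HasDerivAt.fun_sum fun idx _ => hode idx t ht).const_smul N⁻¹
  have hu : ∀ idx t, 0 ≤ t → HasDerivAt (u idx) (D idx t - N⁻¹ • ∑ idx, D idx t) t :=
    fun idx t ht => (hode idx t ht).sub (hxb t ht)
  have hV : ∀ t, 0 ≤ t → HasDerivAt (fun t => ∑ idx, ‖u idx t‖ ^ 2)
      (∑ idx, 2 * ⟪u idx t, D idx t - N⁻¹ • ∑ idx, D idx t⟫) t := fun t ht =>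
    HasDerivAt.fun_sum fun idx _ => (hu idx t ht).norm_sq
  have hzero : ∀ t (w : EuclideanSpace ℝ (Fin n)), ∑ idx, ⟪u idx t, w⟫ = 0 := by
    intro t w
    rw [← sum_inner, hu0, inner_zero_left]
  have hD : ∀ idx t, D idx t = f (x idx t)
      + ∑ k, c k • ∑ j, L k (idx k) j • u (Function.update idx k j) t := by
    intro idx t
    simp only [D, u, smul_sub, Finset.sum_sub_distrib, ← Finset.sum_smul, hLrow]
    simp
  have hcoup : ∀ t, ∑ idx, ⟪u idx t,
      ∑ k, c k • ∑ j, L k (idx k) j • u (Function.update idx k j) t⟫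
        ≤ - g * ∑ idx, ‖u idx t‖ ^ 2 := by
    intro t
    have hcomp : ∀ r, ∑ k, c k * ∑ idx, ∑ j, u idx t r * L k (idx k) j *
        u (Function.update idx k j) t r ≤ - g * ∑ idx, u idx t r ^ 2 := by
      intro r
      refine coupling_bound L hLsym hLrow c g hg0 hgk (fun idx => u idx t r) ?_
      have := congrArg (fun w : EuclideanSpace ℝ (Fin n) => w r) (hu0 t)
      simpa using this
    have hsum := Finset.sum_le_sum fun (r : Fin n) (_ : r ∈ Finset.univ) => hcomp r
    have e1 : ∑ idx, ‖u idx t‖ ^ 2 = ∑ r, ∑ idx, u idx t r ^ 2 := by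
      rw [Finset.sum_comm]
      exact Finset.sum_congr rfl fun idx _ => by rw [EuclideanSpace.real_norm_sq_eq]
    have e2 : ∑ idx, ⟪u idx t,
        ∑ k, c k • ∑ j, L k (idx k) j • u (Function.update idx k j) t⟫
        = ∑ r, ∑ k, c k * ∑ idx, ∑ j, u idx t r * L k (idx k) j *
        u (Function.update idx k j) t r := by
      have e3 : ∀ idx, ⟪u idx t,
        ∑ k, c k • ∑ j, L k (idx k) j • u (Function.update idx k j) t⟫
          = ∑ k, c k * ∑ j, ∑ r, u idx t r * L k (idx k) j *
        u (Function.update idx k j) t r := by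
        intro idx
        rw [inner_sum]
        refine Finset.sum_congr rfl fun k _ => ?_
        rw [inner_smul_right, inner_sum]
        congr 1
        refine Finset.sum_congr rfl fun j _ => ?_
        rw [inner_smul_right, PiLp.inner_apply, Finset.mul_sum]
        refine Finset.sum_congr rfl fun r _ => ?_
        simp
        ring
      simp only [e3]
      rw [Finset.sum_comm, Finset.sum_comm (s := (Finset.univ : Finset (Fin n)))]
      refine Finset.sum_congr rfl fun k _ => ?_
      rw [← Finset.mul_sum, ← Finset.mul_sum]
      congr 1
      rw [Finset.sum_comm (s := (Finset.univ : Finset (Fin n)))]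
      exact Finset.sum_congr rfl fun idx _ => Finset.sum_comm
    rw [e2, e1, Finset.mul_sum]
    exact hsum
  have hle : ∀ t, 0 ≤ t → ∑ idx, 2 * ⟪u idx t, D idx t - N⁻¹ • ∑ idx, D idx t⟫
      ≤ - (2 * (g - α)) * ∑ idx, ‖u idx t‖ ^ 2 := by
    intro t _
    have e1 : ∑ idx, ⟪u idx t, D idx t - N⁻¹ • ∑ idx, D idx t⟫
        = ∑ idx, ⟪u idx t, f (x idx t) - f (xb t)⟫ + ∑ idx, ⟪u idx t,
          ∑ k, c k • ∑ j, L k (idx k) j • u (Function.update idx k j) t⟫ := by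
      simp only [inner_sub_right, Finset.sum_sub_distrib, hzero, sub_zero]
      rw [← Finset.sum_add_distrib]
      refine Finset.sum_congr rfl fun idx _ => ?_
      rw [hD, inner_add_right]
    have e2 : ∑ idx, ⟪u idx t, f (x idx t) - f (xb t)⟫ ≤ α * ∑ idx, ‖u idx t‖ ^ 2 := by
      rw [Finset.mul_sum]
      exact Finset.sum_le_sum fun idx _ => hquad _ _
    rw [← Finset.mul_sum, e1]
    have := hcoup t
    linarith
  have hlim := decay _ _ (2 * (g - α)) (by linarith) hV hle
    (fun t => Finset.sum_nonneg fun _ _ => sq_nonneg _)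
  have hui : ∀ idx, Tendsto (fun t => ‖u idx t‖) atTop (𝓝 0) := by
    intro idx
    have h1 : Tendsto (fun t => Real.sqrt (∑ idx, ‖u idx t‖ ^ 2)) atTop (𝓝 0) := by
      simpa using hlim.sqrt
    refine squeeze_zero (fun t => norm_nonneg _) (fun t => ?_) h1
    refine Real.le_sqrt_of_sq_le ?_
    exact Finset.single_le_sum (f := fun idx => ‖u idx t‖ ^ 2)
      (fun _ _ => sq_nonneg _) (Finset.mem_univ idx)
  refine squeeze_zero (fun t => norm_nonneg _) (fun t => ?_)
    (by simpa using (hui idx₀).add (hui jdx₀))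
  have : x idx₀ t - x jdx₀ t = u idx₀ t - u jdx₀ t := by simp [u]
  rw [this]
  exact norm_sub_le _ _
end

section
/- Consider the multiplex network: for 1 ≤ i ≤ N and 1 ≤ k ≤ K, the states x_i^k(t) ∈ ℝ^n evolve according to d/dt x_i^k(t) = f(x_i^k(t)) + c Σ_{j=1}^N a_{ij} x_j^k(t) + d Σ_{l=1}^K b_{kl} x_i^l(t) for all t ≥ 0, where f satisfies the QUAD condition with constant α, c, d ≥ 0, the intra-layer coupling matrix A = (a_{ij}) is a Laplacian-type coupling matrix with second-eigenvalue bound μ_2, and the inter-layer coupling matrix B = (b_{kl}) is a Laplacian-type coupling matrix with second-eigenvalue bound ν_2. If d ν_2 + α < 0, then the multiplex network realizes inter-layer synchronization: for every node index i and all layers 1 ≤ p,q ≤ K, ‖x_i^p(t) − x_i^q(t)‖ tends to 0 as t → ∞. -/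
open Filter Topology
open scoped RealInnerProductSpace

/-- A Laplacian-type matrix is negative semidefinite, vector-valued version. -/
theorem lap_nonpos {N : ℕ} {E : Type*} [NormedAddCommGroup E] [InnerProductSpace ℝ E]
    (A : Matrix (Fin N) (Fin N) ℝ)
    (hAsym : A.IsSymm) (hArow : ∀ i, ∑ j, A i j = 0) (hAoff : ∀ i j, i ≠ j → 0 ≤ A i j)
    (v : Fin N → E) : ∑ i, ⟪v i, ∑ j, A i j • v j⟫ ≤ 0 := by
  have h1 : ∀ i j, ⟪v i, A i j • v j⟫
      = (A i j * ‖v i‖ ^ 2 + A i j * ‖v j‖ ^ 2 - A i j * ‖v i - v j‖ ^ 2) / 2 := by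
    intro i j
    rw [inner_smul_right, norm_sub_sq_real]
    ring
  have h2 : ∑ i, ∑ j, A i j * ‖v i‖ ^ 2 = 0 := by
    simp [← Finset.sum_mul, hArow]
  have h3 : ∑ i, ∑ j, A i j * ‖v j‖ ^ 2 = 0 := by
    rw [Finset.sum_comm, ← h2]
    refine Finset.sum_congr rfl fun i _ => Finset.sum_congr rfl fun j _ => ?_
    rw [hAsym.apply]
  have h4 : 0 ≤ ∑ i, ∑ j, A i j * ‖v i - v j‖ ^ 2 := by
    refine Finset.sum_nonneg fun i _ => Finset.sum_nonneg fun j _ => ?_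
    by_cases h : i = j
    · simp [h]
    · exact mul_nonneg (hAoff i j h) (sq_nonneg _)
  simp_rw [inner_sum, h1, ← Finset.sum_div, Finset.sum_sub_distrib, Finset.sum_add_distrib]
  rw [h2, h3]
  linarith

theorem scalar_B {K : ℕ} (B : Matrix (Fin K) (Fin K) ℝ) (hBsym : B.IsSymm)
    (hBrow : ∀ k, ∑ l, B k l = 0) (ν₂ : ℝ)
    (hν₂ : ∀ v : Fin K → ℝ, (∑ k, v k) = 0 →
      ∑ k, ∑ l, v k * B k l * v l ≤ ν₂ * ∑ k, (v k) ^ 2) (u : Fin K → ℝ) :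
    ∑ p, ∑ q, (u p - u q) * (∑ l, B p l * u l - ∑ l, B q l * u l)
      ≤ ν₂ * ∑ p, ∑ q, (u p - u q) ^ 2 := by
  rcases Nat.eq_zero_or_pos K with hK | hK
  · subst hK; simp
  have hK' : (0 : ℝ) < K := by exact_mod_cast hK
  have hBcol : ∀ l, ∑ k, B k l = 0 := by
    intro l
    rw [← hBrow l]
    exact Finset.sum_congr rfl fun k _ => hBsym.apply _ _
  set S := ∑ k, u k with hS
  set Q := ∑ k, u k ^ 2 with hQ
  set w : Fin K → ℝ := fun p => ∑ l, B p l * u l with hw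
  set T := ∑ k, u k * w k with hT
  have hw0 : ∑ p, w p = 0 := by
    simp only [hw]
    rw [Finset.sum_comm]
    simp [← Finset.sum_mul, hBcol]
  have e1 : ∑ p, ∑ q, (u p - u q) * (w p - w q) = 2 * K * T := by
    have : ∀ p q, (u p - u q) * (w p - w q) = u p * w p - u p * w q - u q * w p + u q * w q := by
      intros; ring
    simp_rw [this, Finset.sum_add_distrib, Finset.sum_sub_distrib, ← Finset.mul_sum,
      ← Finset.sum_mul]
    have hx : ∑ k, (K : ℝ) * (u k * w k) = K * T := by rw [hT, Finset.mul_sum]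
    simp [hw0, ← Finset.mul_sum, ← hT]
    rw [two_mul, add_mul, add_comm, ← hx]
    simp [mul_assoc, mul_left_comm]
  have e2 : ∑ p, ∑ q, (u p - u q) ^ 2 = 2 * (K * Q - S ^ 2) := by
    have : ∀ p q, (u p - u q) ^ 2 = u p ^ 2 - 2 * (u p * u q) + u q ^ 2 := by
      intros; ring
    simp_rw [this, Finset.sum_add_distrib, Finset.sum_sub_distrib, ← Finset.mul_sum,
      ← Finset.sum_mul]
    simp [← Finset.mul_sum, ← hQ, ← hS]
    ring
  have h := hν₂ (fun k => K * u k - S) (by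
    simp [Finset.sum_sub_distrib, ← Finset.mul_sum, ← hS])
  have e3 : ∑ k, (K * u k - S) ^ 2 = K * (K * Q - S ^ 2) := by
    have : ∀ k, (K * u k - S) ^ 2 = K ^ 2 * u k ^ 2 - 2 * K * S * u k + S ^ 2 := by
      intros; ring
    simp_rw [this, Finset.sum_add_distrib, Finset.sum_sub_distrib, ← Finset.mul_sum]
    simp [← hQ, ← hS]
    ring
  have e4 : ∑ k, ∑ l, (K * u k - S) * B k l * (K * u l - S) = K * (K * T) := by
    have h1 : ∀ k, ∑ l, (K * u k - S) * B k l * (K * u l - S)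
        = K ^ 2 * (u k * w k) - K * S * w k := by
      intro k
      have : ∀ l, (K * u k - S) * B k l * (K * u l - S)
        = (K * u k - S) * K * (B k l * u l) - (K * u k - S) * S * B k l := by
        intros; ring
      simp_rw [this, Finset.sum_sub_distrib, ← Finset.mul_sum, hBrow]
      simp only [hw]
      ring
    simp_rw [h1, Finset.sum_sub_distrib, ← Finset.mul_sum, hw0, ← hT]
    ring
  have h' : (K : ℝ) * (K * T) ≤ K * (ν₂ * (K * Q - S ^ 2)) := by
    rw [← e4]
    refine h.trans (le_of_eq ?_)
    rw [e3]; ring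
  have h'' := le_of_mul_le_mul_left h' hK'
  change ∑ p, ∑ q, (u p - u q) * (w p - w q) ≤ _
  rw [e1, e2]
  linarith

theorem vector_B {n K : ℕ} (B : Matrix (Fin K) (Fin K) ℝ) (hBsym : B.IsSymm)
    (hBrow : ∀ k, ∑ l, B k l = 0) (ν₂ : ℝ)
    (hν₂ : ∀ v : Fin K → ℝ, (∑ k, v k) = 0 →
      ∑ k, ∑ l, v k * B k l * v l ≤ ν₂ * ∑ k, (v k) ^ 2)
    (u : Fin K → EuclideanSpace ℝ (Fin n)) :
    ∑ p, ∑ q, ⟪u p - u q, ∑ l, B p l • u l - ∑ l, B q l • u l⟫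
      ≤ ν₂ * ∑ p, ∑ q, ‖u p - u q‖ ^ 2 := by
  have h := Finset.sum_le_sum fun (m : Fin n) (_ : m ∈ Finset.univ) =>
    scalar_B B hBsym hBrow ν₂ hν₂ (fun p => u p m)
  rw [← Finset.mul_sum] at h
  have e : ∀ F : Fin n → Fin K → Fin K → ℝ, ∑ m, ∑ p, ∑ q, F m p q = ∑ p, ∑ q, ∑ m, F m p q := by
    intro F
    rw [Finset.sum_comm]
    exact Finset.sum_congr rfl fun p _ => Finset.sum_comm
  rw [e, e] at h
  have i1 : ∀ p q, ⟪u p - u q, ∑ l, B p l • u l - ∑ l, B q l • u l⟫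
      = ∑ m, (u p m - u q m) * (∑ l, B p l * u l m - ∑ l, B q l * u l m) := by
    intro p q
    simp [PiLp.inner_apply, mul_comm]
  have i2 : ∀ p q, ‖u p - u q‖ ^ 2 = ∑ m, (u p m - u q m) ^ 2 := by
    intro p q
    simp [EuclideanSpace.norm_sq_eq]
  simp_rw [i1, i2]
  exact h

/-- Exponential decay from a differential inequality. -/
theorem decay_s7 (W W' : ℝ → ℝ) (r : ℝ) (hr : r < 0) (h0 : ∀ t, 0 ≤ W t)
    (hW : ∀ t, 0 ≤ t → HasDerivAt W (W' t) t) (hle : ∀ t, 0 ≤ t → W' t ≤ r * W t) :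
    Tendsto W atTop (𝓝 0) := by
  have hg : ∀ t, 0 ≤ t → HasDerivAt (fun t => W t * Real.exp (-r * t))
      (W' t * Real.exp (-r * t) + W t * (Real.exp (-r * t) * (-r))) t := by
    intro t ht
    have h1 : HasDerivAt (fun t : ℝ => -r * t) (-r) t := by
      simpa using (hasDerivAt_id t).const_mul (-r)
    exact (hW t ht).mul h1.exp
  have hanti : AntitoneOn (fun t => W t * Real.exp (-r * t)) (Set.Ici 0) := by
    refine antitoneOn_of_deriv_nonpos (convex_Ici 0)
      (fun t ht => (hg t ht).continuousAt.continuousWithinAt) ?_ ?_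
    · intro t ht
      rw [interior_Ici] at ht
      exact (hg t (le_of_lt ht)).differentiableAt.differentiableWithinAt
    · intro t ht
      rw [interior_Ici] at ht
      rw [(hg t (le_of_lt ht)).deriv]
      have := mul_le_mul_of_nonneg_right (hle t (le_of_lt ht)) (Real.exp_pos (-r * t)).le
      linarith
  have hb : ∀ t, 0 ≤ t → W t ≤ W 0 * Real.exp (r * t) := by
    intro t ht
    have h := hanti (Set.mem_Ici.2 le_rfl) (Set.mem_Ici.2 ht) ht
    simp only [mul_zero, Real.exp_zero, mul_one] at h
    have h2 := mul_le_mul_of_nonneg_right h (Real.exp_pos (r * t)).le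
    rwa [mul_assoc, ← Real.exp_add, neg_mul, neg_add_cancel, Real.exp_zero, mul_one] at h2
  have hlim : Tendsto (fun t => W 0 * Real.exp (r * t)) atTop (𝓝 0) := by
    have : Tendsto (fun t : ℝ => r * t) atTop atBot := tendsto_id.const_mul_atTop_of_neg hr
    simpa using (Real.tendsto_exp_atBot.comp this).const_mul (W 0)
  refine tendsto_of_tendsto_of_tendsto_of_le_of_le' tendsto_const_nhds hlim
    (Eventually.of_forall h0) ?_
  filter_upwards [eventually_ge_atTop 0] with t ht using hb t ht

theorem multiplex_interlayer_synchronization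
    (n N K : ℕ)
    (f : EuclideanSpace ℝ (Fin n) → EuclideanSpace ℝ (Fin n))
    (hf : Continuous f) (α : ℝ)
    (hquad : ∀ x y : EuclideanSpace ℝ (Fin n), ⟪x - y, f x - f y⟫ ≤ α * ‖x - y‖ ^ 2)
    (c d : ℝ) (hc : 0 ≤ c) (hd : 0 ≤ d)
    (A : Matrix (Fin N) (Fin N) ℝ) (B : Matrix (Fin K) (Fin K) ℝ)
    (hAsym : A.IsSymm) (hBsym : B.IsSymm)
    (hArow : ∀ i, ∑ j, A i j = 0) (hBrow : ∀ k, ∑ l, B k l = 0)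
    (hAoff : ∀ i j, i ≠ j → 0 ≤ A i j) (hBoff : ∀ k l, k ≠ l → 0 ≤ B k l)
    (μ₂ ν₂ : ℝ)
    (hμ₂ : ∀ v : Fin N → ℝ, (∑ i, v i) = 0 →
      ∑ i, ∑ j, v i * A i j * v j ≤ μ₂ * ∑ i, (v i) ^ 2)
    (hν₂ : ∀ v : Fin K → ℝ, (∑ k, v k) = 0 →
      ∑ k, ∑ l, v k * B k l * v l ≤ ν₂ * ∑ k, (v k) ^ 2)
    (x : Fin N → Fin K → ℝ → EuclideanSpace ℝ (Fin n))
    (hode : ∀ i k, ∀ t : ℝ, 0 ≤ t → HasDerivAt (x i k)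
      (f (x i k t) + c • ∑ j, A i j • x j k t + d • ∑ l, B k l • x i l t) t)
    (hsync : d * ν₂ + α < 0) :
    ∀ (i : Fin N) (p q : Fin K),
      Tendsto (fun t : ℝ => ‖x i p t - x i q t‖) atTop (𝓝 0) := by
  intro i₀ p₀ q₀
  have hW := decay_s7 (fun t => ∑ i, ∑ p, ∑ q, ‖x i p t - x i q t‖ ^ 2)
    (fun t => ∑ i, ∑ p, ∑ q, 2 * ⟪x i p t - x i q t,
      (f (x i p t) + c • ∑ j, A i j • x j p t + d • ∑ l, B p l • x i l t) -
      (f (x i q t) + c • ∑ j, A i j • x j q t + d • ∑ l, B q l • x i l t)⟫)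
    (2 * (d * ν₂ + α)) (by linarith)
    (fun t => by positivity)
    (fun t ht => HasDerivAt.fun_sum fun i _ => HasDerivAt.fun_sum fun p _ =>
      HasDerivAt.fun_sum fun q _ => ((hode i p t ht).sub (hode i q t ht)).norm_sq) ?_
  · have hsq : Tendsto (fun t => ‖x i₀ p₀ t - x i₀ q₀ t‖ ^ 2) atTop (𝓝 0) := by
      refine squeeze_zero (fun t => sq_nonneg _) (fun t => ?_) hW
      calc ‖x i₀ p₀ t - x i₀ q₀ t‖ ^ 2 ≤ ∑ q, ‖x i₀ p₀ t - x i₀ q t‖ ^ 2 :=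
            Finset.single_le_sum (f := fun q => ‖x i₀ p₀ t - x i₀ q t‖ ^ 2)
              (fun _ _ => by positivity) (Finset.mem_univ q₀)
        _ ≤ ∑ p, ∑ q, ‖x i₀ p t - x i₀ q t‖ ^ 2 :=
            Finset.single_le_sum (f := fun p => ∑ q, ‖x i₀ p t - x i₀ q t‖ ^ 2)
              (fun _ _ => by positivity) (Finset.mem_univ p₀)
        _ ≤ _ :=
            Finset.single_le_sum (f := fun i => ∑ p, ∑ q, ‖x i p t - x i q t‖ ^ 2)
              (fun _ _ => by positivity) (Finset.mem_univ i₀)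
    have := hsq.sqrt
    simpa [Real.sqrt_sq] using this
  · intro t ht
    have e : ∀ i p q, 2 * ⟪x i p t - x i q t,
        (f (x i p t) + c • ∑ j, A i j • x j p t + d • ∑ l, B p l • x i l t) -
        (f (x i q t) + c • ∑ j, A i j • x j q t + d • ∑ l, B q l • x i l t)⟫
        = 2 * ⟪x i p t - x i q t, f (x i p t) - f (x i q t)⟫
          + 2 * c * ⟪x i p t - x i q t, ∑ j, A i j • (x j p t - x j q t)⟫
          + 2 * d * ⟪x i p t - x i q t, ∑ l, B p l • x i l t - ∑ l, B q l • x i l t⟫ := by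
      intro i p q
      have : (f (x i p t) + c • ∑ j, A i j • x j p t + d • ∑ l, B p l • x i l t) -
        (f (x i q t) + c • ∑ j, A i j • x j q t + d • ∑ l, B q l • x i l t)
        = (f (x i p t) - f (x i q t)) + c • (∑ j, A i j • (x j p t - x j q t))
          + d • (∑ l, B p l • x i l t - ∑ l, B q l • x i l t) := by
        simp only [smul_sub, Finset.sum_sub_distrib]
        abel
      rw [this, inner_add_right, inner_add_right, inner_smul_right, inner_smul_right]
      ring
    have h1 : ∑ i, ∑ p, ∑ q, ⟪x i p t - x i q t, f (x i p t) - f (x i q t)⟫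
        ≤ α * ∑ i, ∑ p, ∑ q, ‖x i p t - x i q t‖ ^ 2 := by
      simp_rw [Finset.mul_sum]
      exact Finset.sum_le_sum fun i _ => Finset.sum_le_sum fun p _ =>
        Finset.sum_le_sum fun q _ => hquad _ _
    have h2 : ∑ i, ∑ p, ∑ q, ⟪x i p t - x i q t, ∑ j, A i j • (x j p t - x j q t)⟫ ≤ 0 := by
      rw [Finset.sum_comm]
      refine Finset.sum_nonpos fun p _ => ?_
      rw [Finset.sum_comm]
      exact Finset.sum_nonpos fun q _ =>
        lap_nonpos A hAsym hArow hAoff (fun i => x i p t - x i q t)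
    have h3 : ∑ i, ∑ p, ∑ q,
          ⟪x i p t - x i q t, ∑ l, B p l • x i l t - ∑ l, B q l • x i l t⟫
        ≤ ν₂ * ∑ i, ∑ p, ∑ q, ‖x i p t - x i q t‖ ^ 2 := by
      rw [Finset.mul_sum]
      exact Finset.sum_le_sum fun i _ =>
        vector_B B hBsym hBrow ν₂ hν₂ (fun p => x i p t)
    simp only [e, Finset.sum_add_distrib, ← Finset.mul_sum]
    have h2' := mul_nonpos_of_nonneg_of_nonpos hc h2
    have h3' := mul_le_mul_of_nonneg_left h3 hd
    linarith
end

section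
/- Consider the 3rd order layered network: for 1 ≤ i_1 ≤ I_1, 1 ≤ i_2 ≤ I_2, 1 ≤ i_3 ≤ I_3, the states x_{i_1,i_2,i_3}(t) ∈ ℝ^n evolve according to d/dt x_{i_1,i_2,i_3}(t) = f(x_{i_1,i_2,i_3}(t)) + c_1 Σ_j l^{(1)}_{i_1 j} x_{j,i_2,i_3}(t) + c_2 Σ_j l^{(2)}_{i_2 j} x_{i_1,j,i_3}(t) + c_3 Σ_j l^{(3)}_{i_3 j} x_{i_1,i_2,j}(t) for all t ≥ 0, where f satisfies the QUAD condition with constant α, c_1, c_2, c_3 ≥ 0, and each L^{(k)} is a Laplacian-type coupling matrix, with λ_2^{(1)} a second-eigenvalue bound for L^{(1)}. Define x̄_{·,i_2,i_3}(t) = (1/I_1) Σ_{j=1}^{I_1} x_{j,i_2,i_3}(t) and the Lyapunov function V(t) = (1/2) Σ_{i_1,i_2,i_3} ‖x_{i_1,i_2,i_3}(t) − x̄_{·,i_2,i_3}(t)‖². Then V is differentiable and its derivative satisfies dV/dt ≤ 2(c_1 λ_2^{(1)} + α) V(t) for all t ≥ 0. -/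
open Filter Topology
open scoped RealInnerProductSpace

lemma quad_vec {n I : ℕ} (L : Matrix (Fin I) (Fin I) ℝ) (lam : ℝ)
    (h : ∀ v : Fin I → ℝ, (∑ i, v i) = 0 →
      ∑ i, ∑ j, v i * L i j * v j ≤ lam * ∑ i, (v i) ^ 2)
    (w : Fin I → EuclideanSpace ℝ (Fin n)) (hw : ∑ i, w i = 0) :
    ∑ i, ⟪w i, ∑ j, L i j • w j⟫ ≤ lam * ∑ i, ‖w i‖ ^ 2 := by
  have h1 : ∑ i, ⟪w i, ∑ j, L i j • w j⟫ = ∑ k, ∑ i, ∑ j, w i k * L i j * w j k := by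
    rw [Finset.sum_comm]
    refine Finset.sum_congr rfl fun i _ => ?_
    simp only [PiLp.inner_apply, WithLp.ofLp_sum, Finset.sum_apply, PiLp.smul_apply, smul_eq_mul,
      WithLp.ofLp_smul, Pi.smul_apply, RCLike.inner_apply, conj_trivial, Finset.sum_mul]
    refine Finset.sum_congr rfl fun k _ => Finset.sum_congr rfl fun j _ => ?_
    ring
  have h2 : ∑ i, ‖w i‖ ^ 2 = ∑ k, ∑ i, (w i k) ^ 2 := by
    rw [Finset.sum_comm]
    refine Finset.sum_congr rfl fun i _ => ?_
    rw [EuclideanSpace.real_norm_sq_eq]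
  rw [h1, h2, Finset.mul_sum]
  refine Finset.sum_le_sum fun k _ => h (fun i => w i k) ?_
  have := congrArg (fun z : EuclideanSpace ℝ (Fin n) => z k) hw
  simpa [WithLp.ofLp_sum, Finset.sum_apply] using this

lemma lap_nonpos_s13 {n I : ℕ} (L : Matrix (Fin I) (Fin I) ℝ) (hs : L.IsSymm)
    (hr : ∀ i, ∑ j, L i j = 0) (ho : ∀ i j, i ≠ j → 0 ≤ L i j)
    (w : Fin I → EuclideanSpace ℝ (Fin n)) :
    ∑ i, ⟪w i, ∑ j, L i j • w j⟫ ≤ 0 := by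
  have hc : ∀ j, ∑ i, L i j = 0 := fun j => by
    rw [← hr j]
    exact Finset.sum_congr rfl fun i _ => hs.apply j i
  have key : ∀ i j, L i j * ⟪w i, w j⟫ ≤ L i j * (‖w i‖ ^ 2 / 2) + L i j * (‖w j‖ ^ 2 / 2) := by
    intro i j
    by_cases hij : i = j
    · subst hij
      rw [real_inner_self_eq_norm_sq]
      linarith
    · have h1 := norm_sub_sq_real (w i) (w j)
      have h2 : ⟪w i, w j⟫ ≤ ‖w i‖ ^ 2 / 2 + ‖w j‖ ^ 2 / 2 := by
        nlinarith [sq_nonneg ‖w i - w j‖]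
      have := mul_le_mul_of_nonneg_left h2 (ho i j hij)
      linarith
  calc ∑ i, ⟪w i, ∑ j, L i j • w j⟫ = ∑ i, ∑ j, L i j * ⟪w i, w j⟫ := by
        simp only [inner_sum, real_inner_smul_right]
    _ ≤ ∑ i, ∑ j, (L i j * (‖w i‖ ^ 2 / 2) + L i j * (‖w j‖ ^ 2 / 2)) :=
        Finset.sum_le_sum fun i _ => Finset.sum_le_sum fun j _ => key i j
    _ = 0 := by
        simp only [Finset.sum_add_distrib]
        rw [Finset.sum_comm (f := fun i j => L i j * (‖w j‖ ^ 2 / 2))]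
        simp only [← Finset.sum_mul, hr, hc, zero_mul, Finset.sum_const_zero, add_zero]

theorem lyapunov_derivative_bound
    (n I₁ I₂ I₃ : ℕ)
    (f : EuclideanSpace ℝ (Fin n) → EuclideanSpace ℝ (Fin n))
    (hf : Continuous f) (α : ℝ)
    (hquad : ∀ x y : EuclideanSpace ℝ (Fin n), ⟪x - y, f x - f y⟫ ≤ α * ‖x - y‖ ^ 2)
    (c₁ c₂ c₃ : ℝ) (hc₁ : 0 ≤ c₁) (hc₂ : 0 ≤ c₂) (hc₃ : 0 ≤ c₃)
    (L₁ : Matrix (Fin I₁) (Fin I₁) ℝ) (L₂ : Matrix (Fin I₂) (Fin I₂) ℝ)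
    (L₃ : Matrix (Fin I₃) (Fin I₃) ℝ)
    (hL₁sym : L₁.IsSymm) (hL₂sym : L₂.IsSymm) (hL₃sym : L₃.IsSymm)
    (hL₁row : ∀ i, ∑ j, L₁ i j = 0) (hL₂row : ∀ i, ∑ j, L₂ i j = 0)
    (hL₃row : ∀ i, ∑ j, L₃ i j = 0)
    (hL₁off : ∀ i j, i ≠ j → 0 ≤ L₁ i j) (hL₂off : ∀ i j, i ≠ j → 0 ≤ L₂ i j)
    (hL₃off : ∀ i j, i ≠ j → 0 ≤ L₃ i j)
    (lam₁ : ℝ)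
    (hlam₁ : ∀ v : Fin I₁ → ℝ, (∑ i, v i) = 0 →
      ∑ i, ∑ j, v i * L₁ i j * v j ≤ lam₁ * ∑ i, (v i) ^ 2)
    (x : Fin I₁ → Fin I₂ → Fin I₃ → ℝ → EuclideanSpace ℝ (Fin n))
    (hode : ∀ i₁ i₂ i₃, ∀ t : ℝ, 0 ≤ t → HasDerivAt (x i₁ i₂ i₃)
      (f (x i₁ i₂ i₃ t) + c₁ • ∑ j, L₁ i₁ j • x j i₂ i₃ t
        + c₂ • ∑ j, L₂ i₂ j • x i₁ j i₃ t
        + c₃ • ∑ j, L₃ i₃ j • x i₁ i₂ j t) t) :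
    ∀ t : ℝ, 0 ≤ t →
      ∃ V' : ℝ,
        HasDerivAt (fun s : ℝ => (1 / 2 : ℝ) * ∑ i₁, ∑ i₂, ∑ i₃,
            ‖x i₁ i₂ i₃ s - (I₁ : ℝ)⁻¹ • ∑ j, x j i₂ i₃ s‖ ^ 2) V' t ∧
        V' ≤ 2 * (c₁ * lam₁ + α) * ((1 / 2 : ℝ) * ∑ i₁, ∑ i₂, ∑ i₃,
            ‖x i₁ i₂ i₃ t - (I₁ : ℝ)⁻¹ • ∑ j, x j i₂ i₃ t‖ ^ 2) := by
  intro t ht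
  set m : Fin I₂ → Fin I₃ → EuclideanSpace ℝ (Fin n) :=
    fun i₂ i₃ => (I₁ : ℝ)⁻¹ • ∑ j, x j i₂ i₃ t with hm
  set e : Fin I₁ → Fin I₂ → Fin I₃ → EuclideanSpace ℝ (Fin n) :=
    fun i₁ i₂ i₃ => x i₁ i₂ i₃ t - m i₂ i₃ with he
  set F : Fin I₁ → Fin I₂ → Fin I₃ → EuclideanSpace ℝ (Fin n) :=
    fun i₁ i₂ i₃ => f (x i₁ i₂ i₃ t) + c₁ • ∑ j, L₁ i₁ j • x j i₂ i₃ t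
        + c₂ • ∑ j, L₂ i₂ j • x i₁ j i₃ t
        + c₃ • ∑ j, L₃ i₃ j • x i₁ i₂ j t with hF
  have hx : ∀ i₁ i₂ i₃, HasDerivAt (x i₁ i₂ i₃) (F i₁ i₂ i₃) t :=
    fun i₁ i₂ i₃ => hode i₁ i₂ i₃ t ht
  have hesum : ∀ i₂ i₃, ∑ i₁, e i₁ i₂ i₃ = 0 := by
    intro i₂ i₃
    rcases Nat.eq_zero_or_pos I₁ with h0 | h0
    · subst h0
      simp
    · have h0' : (I₁ : ℝ) ≠ 0 := by positivity
      simp only [he, hm, Finset.sum_sub_distrib, Finset.sum_const, Finset.card_univ,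
        Fintype.card_fin]
      rw [← Nat.cast_smul_eq_nsmul ℝ, smul_smul, mul_inv_cancel₀ h0', one_smul, sub_self]
  refine ⟨(1 / 2 : ℝ) * ∑ i₁, ∑ i₂, ∑ i₃,
    2 * ⟪e i₁ i₂ i₃, F i₁ i₂ i₃ - (I₁ : ℝ)⁻¹ • ∑ j, F j i₂ i₃⟫, ?_, ?_⟩
  · refine HasDerivAt.const_mul _ ?_
    refine HasDerivAt.fun_sum fun i₁ _ => HasDerivAt.fun_sum fun i₂ _ =>
      HasDerivAt.fun_sum fun i₃ _ => ?_
    exact ((hx i₁ i₂ i₃).fun_sub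
      ((HasDerivAt.fun_sum fun j _ => hx j i₂ i₃).fun_const_smul _)).norm_sq
  · change _ ≤ 2 * (c₁ * lam₁ + α) * ((1 / 2 : ℝ) * ∑ i₁, ∑ i₂, ∑ i₃, ‖e i₁ i₂ i₃‖ ^ 2)
    -- replace the mean of `F` by another vector independent of `i₁`
    set m' : Fin I₂ → Fin I₃ → EuclideanSpace ℝ (Fin n) := fun i₂ i₃ =>
      f (m i₂ i₃) + c₂ • ∑ j, L₂ i₂ j • m j i₃ + c₃ • ∑ j, L₃ i₃ j • m i₂ j with hm'
    have hFm : ∀ i₁ i₂ i₃, F i₁ i₂ i₃ - m' i₂ i₃ = (f (x i₁ i₂ i₃ t) - f (m i₂ i₃))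
        + c₁ • ∑ j, L₁ i₁ j • e j i₂ i₃ + c₂ • ∑ j, L₂ i₂ j • e i₁ j i₃
        + c₃ • ∑ j, L₃ i₃ j • e i₁ i₂ j := by
      intro i₁ i₂ i₃
      have h1 : ∑ j, L₁ i₁ j • e j i₂ i₃ = ∑ j, L₁ i₁ j • x j i₂ i₃ t := by
        simp only [he, smul_sub, Finset.sum_sub_distrib, ← Finset.sum_smul, hL₁row, zero_smul,
          sub_zero]
      rw [h1]
      simp only [he, smul_sub, Finset.sum_sub_distrib, hF, hm']
      abel
    have hswap : ∀ i₂ i₃ (a b : EuclideanSpace ℝ (Fin n)),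
        ∑ i₁, ⟪e i₁ i₂ i₃, F i₁ i₂ i₃ - a⟫ = ∑ i₁, ⟪e i₁ i₂ i₃, F i₁ i₂ i₃ - b⟫ := by
      intro i₂ i₃ a b
      simp only [inner_sub_right, Finset.sum_sub_distrib, ← sum_inner, hesum, inner_zero_left]
    have hrot : ∀ g : Fin I₁ → Fin I₂ → Fin I₃ → ℝ,
        ∑ i₁, ∑ i₂, ∑ i₃, g i₁ i₂ i₃ = ∑ i₂, ∑ i₃, ∑ i₁, g i₁ i₂ i₃ := by
      intro g
      rw [Finset.sum_comm]
      exact Finset.sum_congr rfl fun i₂ _ => Finset.sum_comm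
    have hD : ∑ i₁, ∑ i₂, ∑ i₃, ⟪e i₁ i₂ i₃, F i₁ i₂ i₃ - (I₁ : ℝ)⁻¹ • ∑ j, F j i₂ i₃⟫
        = ∑ i₁, ∑ i₂, ∑ i₃, ⟪e i₁ i₂ i₃, f (x i₁ i₂ i₃ t) - f (m i₂ i₃)⟫
          + c₁ * ∑ i₁, ∑ i₂, ∑ i₃, ⟪e i₁ i₂ i₃, ∑ j, L₁ i₁ j • e j i₂ i₃⟫
          + c₂ * ∑ i₁, ∑ i₂, ∑ i₃, ⟪e i₁ i₂ i₃, ∑ j, L₂ i₂ j • e i₁ j i₃⟫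
          + c₃ * ∑ i₁, ∑ i₂, ∑ i₃, ⟪e i₁ i₂ i₃, ∑ j, L₃ i₃ j • e i₁ i₂ j⟫ := by
      have : ∑ i₁, ∑ i₂, ∑ i₃, ⟪e i₁ i₂ i₃, F i₁ i₂ i₃ - (I₁ : ℝ)⁻¹ • ∑ j, F j i₂ i₃⟫
          = ∑ i₁, ∑ i₂, ∑ i₃, ⟪e i₁ i₂ i₃, F i₁ i₂ i₃ - m' i₂ i₃⟫ := by
        rw [hrot, hrot]
        exact Finset.sum_congr rfl fun i₂ _ => Finset.sum_congr rfl fun i₃ _ => hswap _ _ _ _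
      rw [this]
      simp only [hFm, inner_add_right, real_inner_smul_right, Finset.sum_add_distrib,
        Finset.mul_sum]
    have b0 : ∑ i₁, ∑ i₂, ∑ i₃, ⟪e i₁ i₂ i₃, f (x i₁ i₂ i₃ t) - f (m i₂ i₃)⟫
        ≤ α * ∑ i₁, ∑ i₂, ∑ i₃, ‖e i₁ i₂ i₃‖ ^ 2 := by
      simp only [Finset.mul_sum]
      exact Finset.sum_le_sum fun i₁ _ => Finset.sum_le_sum fun i₂ _ =>
        Finset.sum_le_sum fun i₃ _ => hquad _ _
    have b1 : ∑ i₁, ∑ i₂, ∑ i₃, ⟪e i₁ i₂ i₃, ∑ j, L₁ i₁ j • e j i₂ i₃⟫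
        ≤ lam₁ * ∑ i₁, ∑ i₂, ∑ i₃, ‖e i₁ i₂ i₃‖ ^ 2 := by
      rw [hrot, hrot]
      rw [Finset.mul_sum]
      refine Finset.sum_le_sum fun i₂ _ => ?_
      rw [Finset.mul_sum]
      exact Finset.sum_le_sum fun i₃ _ =>
        quad_vec L₁ lam₁ hlam₁ (fun i₁ => e i₁ i₂ i₃) (hesum i₂ i₃)
    have b2 : ∑ i₁, ∑ i₂, ∑ i₃, ⟪e i₁ i₂ i₃, ∑ j, L₂ i₂ j • e i₁ j i₃⟫ ≤ 0 := by
      refine Finset.sum_nonpos fun i₁ _ => ?_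
      rw [Finset.sum_comm]
      exact Finset.sum_nonpos fun i₃ _ =>
        lap_nonpos_s13 L₂ hL₂sym hL₂row hL₂off (fun i₂ => e i₁ i₂ i₃)
    have b3 : ∑ i₁, ∑ i₂, ∑ i₃, ⟪e i₁ i₂ i₃, ∑ j, L₃ i₃ j • e i₁ i₂ j⟫ ≤ 0 :=
      Finset.sum_nonpos fun i₁ _ => Finset.sum_nonpos fun i₂ _ =>
        lap_nonpos_s13 L₃ hL₃sym hL₃row hL₃off (fun i₃ => e i₁ i₂ i₃)
    simp only [← Finset.mul_sum]
    rw [hD]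
    have d1 := mul_le_mul_of_nonneg_left b1 hc₁
    have d2 := mul_nonpos_of_nonneg_of_nonpos hc₂ b2
    have d3 := mul_nonpos_of_nonneg_of_nonpos hc₃ b3
    linarith
end

section
/- Consider the 3rd order layered network: for 1 ≤ i_1 ≤ I_1, 1 ≤ i_2 ≤ I_2, 1 ≤ i_3 ≤ I_3, the states x_{i_1,i_2,i_3}(t) ∈ ℝ^n evolve according to d/dt x_{i_1,i_2,i_3}(t) = f(x_{i_1,i_2,i_3}(t)) + c_1 Σ_j l^{(1)}_{i_1 j} x_{j,i_2,i_3}(t) + c_2 Σ_j l^{(2)}_{i_2 j} x_{i_1,j,i_3}(t) + c_3 Σ_j l^{(3)}_{i_3 j} x_{i_1,i_2,j}(t) for all t ≥ 0, where f satisfies the QUAD condition with constant α, c_1, c_2, c_3 ≥ 0, and each L^{(k)} is a Laplacian-type coupling matrix, with λ_2^{(1)} a second-eigenvalue bound for L^{(1)}. Define x̄_{·,i_2,i_3}(t) = (1/I_1) Σ_{j=1}^{I_1} x_{j,i_2,i_3}(t) and the Lyapunov function V(t) = (1/2) Σ_{i_1,i_2,i_3} ‖x_{i_1,i_2,i_3}(t)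 − x̄_{·,i_2,i_3}(t)‖². Then V(t) ≤ V(0)·exp(2(c_1 λ_2^{(1)} + α)t) for all t ≥ 0. -/
open Filter Topology
open scoped RealInnerProductSpace

theorem aux_nsd {E : Type*} [NormedAddCommGroup E] [InnerProductSpace ℝ E] {m : ℕ}
    (L : Matrix (Fin m) (Fin m) ℝ) (hsym : L.IsSymm) (hrow : ∀ i, ∑ j, L i j = 0)
    (hoff : ∀ i j, i ≠ j → 0 ≤ L i j) (u : Fin m → E) :
    ∑ i, ⟪u i, ∑ j, L i j • u j⟫ ≤ 0 := by
  have h0 : 0 ≤ ∑ i, ∑ j, L i j * ‖u i - u j‖ ^ 2 := by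
    refine Finset.sum_nonneg fun i _ => Finset.sum_nonneg fun j _ => ?_
    by_cases h : i = j
    · simp [h]
    · exact mul_nonneg (hoff i j h) (sq_nonneg _)
  have h1 : ∑ i, ∑ j, L i j * ‖u i‖ ^ 2 = 0 := by
    simp [← Finset.sum_mul, hrow]
  have h2 : ∑ i, ∑ j, L i j * ‖u j‖ ^ 2 = 0 := by
    rw [Finset.sum_comm, ← h1]
    exact Finset.sum_congr rfl fun i _ => Finset.sum_congr rfl fun j _ => by rw [hsym.apply]
  have h3 : ∑ i, ∑ j, L i j * ‖u i - u j‖ ^ 2 = ∑ i, ∑ j, L i j * ‖u i‖ ^ 2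
      + ∑ i, ∑ j, L i j * ‖u j‖ ^ 2 - 2 * ∑ i, ⟪u i, ∑ j, L i j • u j⟫ := by
    simp only [inner_sum, inner_smul_right, Finset.mul_sum, ← Finset.sum_add_distrib,
      ← Finset.sum_sub_distrib]
    refine Finset.sum_congr rfl fun i _ => Finset.sum_congr rfl fun j _ => ?_
    rw [norm_sub_sq_real]; ring
  linarith

theorem aux_lam {n m : ℕ} (L : Matrix (Fin m) (Fin m) ℝ) (lam : ℝ)
    (hlam : ∀ v : Fin m → ℝ, (∑ i, v i) = 0 →
      ∑ i, ∑ j, v i * L i j * v j ≤ lam * ∑ i, (v i) ^ 2)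
    (u : Fin m → EuclideanSpace ℝ (Fin n)) (hu : ∑ i, u i = 0) :
    ∑ i, ⟪u i, ∑ j, L i j • u j⟫ ≤ lam * ∑ i, ‖u i‖ ^ 2 := by
  have h1 : ∑ i, ⟪u i, ∑ j, L i j • u j⟫ = ∑ k, ∑ i, ∑ j, u i k * L i j * u j k := by
    rw [Finset.sum_comm]
    refine Finset.sum_congr rfl fun i _ => ?_
    rw [Finset.sum_comm, inner_sum]
    refine Finset.sum_congr rfl fun j _ => ?_
    rw [inner_smul_right, PiLp.inner_apply, Finset.mul_sum]
    refine Finset.sum_congr rfl fun k _ => ?_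
    simp; ring
  have h2 : ∑ i, ‖u i‖ ^ 2 = ∑ k, ∑ i, (u i k) ^ 2 := by
    rw [Finset.sum_comm]
    refine Finset.sum_congr rfl fun i _ => ?_
    rw [EuclideanSpace.norm_sq_eq]
    simp
  rw [h1, h2, Finset.mul_sum]
  refine Finset.sum_le_sum fun k _ => hlam (fun i => u i k) ?_
  have := congrArg (fun w : EuclideanSpace ℝ (Fin n) => w k) hu
  simpa using this

theorem aux_mean {E : Type*} [NormedAddCommGroup E] [InnerProductSpace ℝ E] {m : ℕ}
    (u : Fin m → E) : ∑ i, (u i - (m : ℝ)⁻¹ • ∑ j, u j) = 0 := by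
  rcases Nat.eq_zero_or_pos m with h | h
  · subst h; simp
  · have : (m : ℝ) ≠ 0 := by positivity
    rw [Finset.sum_sub_distrib, Finset.sum_const, Finset.card_univ, Fintype.card_fin,
      ← Nat.cast_smul_eq_nsmul ℝ, smul_smul, mul_inv_cancel₀ this, one_smul, sub_self]

theorem aux_gronwall (V V' : ℝ → ℝ) (k : ℝ) (hV : ∀ t, 0 ≤ t → HasDerivAt V (V' t) t)
    (hle : ∀ t, 0 ≤ t → V' t ≤ k * V t) (t : ℝ) (ht : 0 ≤ t) :
    V t ≤ V 0 * Real.exp (k * t) := by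
  have hd : ∀ s, 0 ≤ s → HasDerivAt (fun s => V s * Real.exp (-(k * s)))
      (V' s * Real.exp (-(k * s)) + V s * (Real.exp (-(k * s)) * (-(k * 1)))) s := fun s hs =>
    (hV s hs).mul (((hasDerivAt_id s).const_mul k).neg.exp)
  have hanti : AntitoneOn (fun s => V s * Real.exp (-(k * s))) (Set.Ici 0) := by
    refine antitoneOn_of_deriv_nonpos (convex_Ici 0)
      (fun s hs => (hd s hs).continuousAt.continuousWithinAt) ?_ ?_
    · intro s hs
      exact (hd s (interior_subset hs)).differentiableAt.differentiableWithinAt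
    · intro s hs
      rw [(hd s (interior_subset hs)).deriv]
      have := mul_nonneg (sub_nonneg.2 (hle s (interior_subset hs))) (Real.exp_pos (-(k * s))).le
      linarith
  have h := hanti (Set.mem_Ici.2 le_rfl) (Set.mem_Ici.2 ht) ht
  simp only [mul_zero, neg_zero, Real.exp_zero, mul_one] at h
  rw [Real.exp_neg, ← div_eq_mul_inv, div_le_iff₀ (Real.exp_pos _)] at h
  exact h

theorem lyapunov_exponential_bound
    (n I₁ I₂ I₃ : ℕ)
    (f : EuclideanSpace ℝ (Fin n) → EuclideanSpace ℝ (Fin n))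
    (hf : Continuous f) (α : ℝ)
    (hquad : ∀ x y : EuclideanSpace ℝ (Fin n), ⟪x - y, f x - f y⟫ ≤ α * ‖x - y‖ ^ 2)
    (c₁ c₂ c₃ : ℝ) (hc₁ : 0 ≤ c₁) (hc₂ : 0 ≤ c₂) (hc₃ : 0 ≤ c₃)
    (L₁ : Matrix (Fin I₁) (Fin I₁) ℝ) (L₂ : Matrix (Fin I₂) (Fin I₂) ℝ)
    (L₃ : Matrix (Fin I₃) (Fin I₃) ℝ)
    (hL₁sym : L₁.IsSymm) (hL₂sym : L₂.IsSymm) (hL₃sym : L₃.IsSymm)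
    (hL₁row : ∀ i, ∑ j, L₁ i j = 0) (hL₂row : ∀ i, ∑ j, L₂ i j = 0)
    (hL₃row : ∀ i, ∑ j, L₃ i j = 0)
    (hL₁off : ∀ i j, i ≠ j → 0 ≤ L₁ i j) (hL₂off : ∀ i j, i ≠ j → 0 ≤ L₂ i j)
    (hL₃off : ∀ i j, i ≠ j → 0 ≤ L₃ i j)
    (lam₁ : ℝ)
    (hlam₁ : ∀ v : Fin I₁ → ℝ, (∑ i, v i) = 0 →
      ∑ i, ∑ j, v i * L₁ i j * v j ≤ lam₁ * ∑ i, (v i) ^ 2)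
    (x : Fin I₁ → Fin I₂ → Fin I₃ → ℝ → EuclideanSpace ℝ (Fin n))
    (hode : ∀ i₁ i₂ i₃, ∀ t : ℝ, 0 ≤ t → HasDerivAt (x i₁ i₂ i₃)
      (f (x i₁ i₂ i₃ t) + c₁ • ∑ j, L₁ i₁ j • x j i₂ i₃ t
        + c₂ • ∑ j, L₂ i₂ j • x i₁ j i₃ t
        + c₃ • ∑ j, L₃ i₃ j • x i₁ i₂ j t) t) :
    ∀ t : ℝ, 0 ≤ t →
      (1 / 2 : ℝ) * (∑ i₁, ∑ i₂, ∑ i₃,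
          ‖x i₁ i₂ i₃ t - (I₁ : ℝ)⁻¹ • ∑ j, x j i₂ i₃ t‖ ^ 2) ≤
        ((1 / 2 : ℝ) * ∑ i₁, ∑ i₂, ∑ i₃,
          ‖x i₁ i₂ i₃ 0 - (I₁ : ℝ)⁻¹ • ∑ j, x j i₂ i₃ 0‖ ^ 2) *
          Real.exp (2 * (c₁ * lam₁ + α) * t) := by
  set D : Fin I₁ → Fin I₂ → Fin I₃ → ℝ → EuclideanSpace ℝ (Fin n) := fun i₁ i₂ i₃ t =>
    f (x i₁ i₂ i₃ t) + c₁ • ∑ j, L₁ i₁ j • x j i₂ i₃ t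
        + c₂ • ∑ j, L₂ i₂ j • x i₁ j i₃ t
        + c₃ • ∑ j, L₃ i₃ j • x i₁ i₂ j t with hD
  set b : Fin I₂ → Fin I₃ → ℝ → EuclideanSpace ℝ (Fin n) := fun i₂ i₃ t =>
    (I₁ : ℝ)⁻¹ • ∑ j, x j i₂ i₃ t with hb
  set e : Fin I₁ → Fin I₂ → Fin I₃ → ℝ → EuclideanSpace ℝ (Fin n) := fun i₁ i₂ i₃ t =>
    x i₁ i₂ i₃ t - b i₂ i₃ t with he
  set D' : Fin I₁ → Fin I₂ → Fin I₃ → ℝ → EuclideanSpace ℝ (Fin n) := fun i₁ i₂ i₃ t =>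
    D i₁ i₂ i₃ t - (I₁ : ℝ)⁻¹ • ∑ j, D j i₂ i₃ t with hD'
  have hde : ∀ i₁ i₂ i₃ t, 0 ≤ t → HasDerivAt (e i₁ i₂ i₃) (D' i₁ i₂ i₃ t) t := by
    intro i₁ i₂ i₃ t ht
    have hs : HasDerivAt (fun s => ∑ j, x j i₂ i₃ s) (∑ j, D j i₂ i₃ t) t :=
      HasDerivAt.fun_sum fun j _ => hode j i₂ i₃ t ht
    have hs' : HasDerivAt (b i₂ i₃) ((I₁ : ℝ)⁻¹ • ∑ j, D j i₂ i₃ t) t :=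
      hs.const_smul (I₁ : ℝ)⁻¹
    exact (hode i₁ i₂ i₃ t ht).sub hs'
  have hmean : ∀ i₂ i₃ t, ∑ i₁, e i₁ i₂ i₃ t = 0 := fun i₂ i₃ t =>
    aux_mean fun i₁ => x i₁ i₂ i₃ t
  refine aux_gronwall (fun t => (1 / 2 : ℝ) * ∑ i₁, ∑ i₂, ∑ i₃, ‖e i₁ i₂ i₃ t‖ ^ 2)
    (fun t => (1 / 2 : ℝ) * ∑ i₁, ∑ i₂, ∑ i₃, 2 * ⟪e i₁ i₂ i₃ t, D' i₁ i₂ i₃ t⟫)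
    (2 * (c₁ * lam₁ + α)) ?_ ?_
  · intro t ht
    refine HasDerivAt.const_mul _ ?_
    exact HasDerivAt.fun_sum fun i₁ _ => HasDerivAt.fun_sum fun i₂ _ =>
      HasDerivAt.fun_sum fun i₃ _ => (hde i₁ i₂ i₃ t ht).norm_sq
  intro t _
  have hdec : ∀ i₁ i₂ i₃, D' i₁ i₂ i₃ t = (f (x i₁ i₂ i₃ t) - f (b i₂ i₃ t))
      + c₁ • ∑ j, L₁ i₁ j • e j i₂ i₃ t + c₂ • ∑ j, L₂ i₂ j • e i₁ j i₃ t
      + c₃ • ∑ j, L₃ i₃ j • e i₁ i₂ j t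
      + (f (b i₂ i₃ t) + c₂ • ∑ j, L₂ i₂ j • b j i₃ t + c₃ • ∑ j, L₃ i₃ j • b i₂ j t
        - (I₁ : ℝ)⁻¹ • ∑ j, D j i₂ i₃ t) := by
    intro i₁ i₂ i₃
    have h1 : ∑ j, L₁ i₁ j • e j i₂ i₃ t = ∑ j, L₁ i₁ j • x j i₂ i₃ t := by
      simp only [he, smul_sub, Finset.sum_sub_distrib, ← Finset.sum_smul, hL₁row, zero_smul,
        sub_zero]
    have h2 : ∑ j, L₂ i₂ j • e i₁ j i₃ t
        = ∑ j, L₂ i₂ j • x i₁ j i₃ t - ∑ j, L₂ i₂ j • b j i₃ t := by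
      simp only [he, smul_sub, Finset.sum_sub_distrib]
    have h3 : ∑ j, L₃ i₃ j • e i₁ i₂ j t
        = ∑ j, L₃ i₃ j • x i₁ i₂ j t - ∑ j, L₃ i₃ j • b i₂ j t := by
      simp only [he, smul_sub, Finset.sum_sub_distrib]
    rw [h1, h2, h3, smul_sub, smul_sub]
    have : D' i₁ i₂ i₃ t = D i₁ i₂ i₃ t - (I₁ : ℝ)⁻¹ • ∑ j, D j i₂ i₃ t := rfl
    rw [this]
    generalize (I₁ : ℝ)⁻¹ • ∑ j, D j i₂ i₃ t = r
    simp only [hD]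
    abel
  generalize hR : (fun i₂ i₃ => (f (b i₂ i₃ t) + c₂ • ∑ j, L₂ i₂ j • b j i₃ t
    + c₃ • ∑ j, L₃ i₃ j • b i₂ j t - (I₁ : ℝ)⁻¹ • ∑ j, D j i₂ i₃ t)) = R
  have hdec' : ∀ i₁ i₂ i₃, ⟪e i₁ i₂ i₃ t, D' i₁ i₂ i₃ t⟫ =
      ⟪e i₁ i₂ i₃ t, f (x i₁ i₂ i₃ t) - f (b i₂ i₃ t)⟫
      + c₁ * ⟪e i₁ i₂ i₃ t, ∑ j, L₁ i₁ j • e j i₂ i₃ t⟫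
      + c₂ * ⟪e i₁ i₂ i₃ t, ∑ j, L₂ i₂ j • e i₁ j i₃ t⟫
      + c₃ * ⟪e i₁ i₂ i₃ t, ∑ j, L₃ i₃ j • e i₁ i₂ j t⟫
      + ⟪e i₁ i₂ i₃ t, R i₂ i₃⟫ := by
    intro i₁ i₂ i₃
    rw [hdec, ← hR]
    simp only [inner_add_right _ _ (_ - _), inner_add_right _ _ (_ • _), inner_smul_right]
  have k0 : ∑ i₁, ∑ i₂, ∑ i₃, ⟪e i₁ i₂ i₃ t, f (x i₁ i₂ i₃ t) - f (b i₂ i₃ t)⟫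
      ≤ α * ∑ i₁, ∑ i₂, ∑ i₃, ‖e i₁ i₂ i₃ t‖ ^ 2 := by
    simp only [Finset.mul_sum]
    exact Finset.sum_le_sum fun i₁ _ => Finset.sum_le_sum fun i₂ _ =>
      Finset.sum_le_sum fun i₃ _ => hquad _ _
  have comm1 : ∀ g : Fin I₁ → Fin I₂ → Fin I₃ → ℝ,
      ∑ i₁, ∑ i₂, ∑ i₃, g i₁ i₂ i₃ = ∑ i₂, ∑ i₃, ∑ i₁, g i₁ i₂ i₃ := by
    intro g
    rw [Finset.sum_comm]
    exact Finset.sum_congr rfl fun i₂ _ => Finset.sum_comm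
  have k1 : ∑ i₁, ∑ i₂, ∑ i₃, ⟪e i₁ i₂ i₃ t, ∑ j, L₁ i₁ j • e j i₂ i₃ t⟫
      ≤ lam₁ * ∑ i₁, ∑ i₂, ∑ i₃, ‖e i₁ i₂ i₃ t‖ ^ 2 := by
    rw [comm1, comm1, Finset.mul_sum]
    refine Finset.sum_le_sum fun i₂ _ => ?_
    rw [Finset.mul_sum]
    exact Finset.sum_le_sum fun i₃ _ =>
      aux_lam L₁ lam₁ hlam₁ (fun i₁ => e i₁ i₂ i₃ t) (hmean i₂ i₃ t)
  have k2 : ∑ i₁, ∑ i₂, ∑ i₃, ⟪e i₁ i₂ i₃ t, ∑ j, L₂ i₂ j • e i₁ j i₃ t⟫ ≤ 0 := by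
    refine Finset.sum_nonpos fun i₁ _ => ?_
    rw [Finset.sum_comm]
    exact Finset.sum_nonpos fun i₃ _ =>
      aux_nsd L₂ hL₂sym hL₂row hL₂off (fun i₂ => e i₁ i₂ i₃ t)
  have k3 : ∑ i₁, ∑ i₂, ∑ i₃, ⟪e i₁ i₂ i₃ t, ∑ j, L₃ i₃ j • e i₁ i₂ j t⟫ ≤ 0 :=
    Finset.sum_nonpos fun i₁ _ => Finset.sum_nonpos fun i₂ _ =>
      aux_nsd L₃ hL₃sym hL₃row hL₃off (fun i₃ => e i₁ i₂ i₃ t)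
  have k4 : ∑ i₁, ∑ i₂, ∑ i₃, ⟪e i₁ i₂ i₃ t, R i₂ i₃⟫ = 0 := by
    rw [comm1]
    simp only [← sum_inner, hmean, inner_zero_left, Finset.sum_const_zero]
  have hfin : ∑ i₁, ∑ i₂, ∑ i₃, ⟪e i₁ i₂ i₃ t, D' i₁ i₂ i₃ t⟫
      ≤ (c₁ * lam₁ + α) * ∑ i₁, ∑ i₂, ∑ i₃, ‖e i₁ i₂ i₃ t‖ ^ 2 := by
    simp only [hdec', Finset.sum_add_distrib, ← Finset.mul_sum]
    have m1 := mul_le_mul_of_nonneg_left k1 hc₁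
    have m2 := mul_le_mul_of_nonneg_left k2 hc₂
    have m3 := mul_le_mul_of_nonneg_left k3 hc₃
    linarith
  simp only [← Finset.mul_sum]
  linarith
end
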